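/- arXiv:1601.05917 — 2 statements merged into one kernel-verified Lean document; each statement's English description precedes it below -/
import Mathlib

section
/- Consider a BCSI with noncausal state, with binary input alphabet X_in = {0,1} replaced more generally as follows: finite input alphabet X, finite state alphabet S with state pmf P_S, finite output alphabets Y₁, Y₂, and channel W(y₁,y₂|x,s). Let V₁, V₂ be {0,1}-valued, let P_{V₁V₂S} be a joint pmf on {0,1}×{0,1}×S whose S-marginal is P_S, let f : {0,1}×{0,1}×S → X, and let (V₁,V₂,S,Y₁,Y₂) have joint pmf P_{V₁V₂S}(v₁,v₂,s)·W(y₁,y₂| f(v₁,v₂,s), s). Assume I(V₂;Y₁|V₁) > I(V₂;S|V₁), I(V₁;Y₁) > I(V₁;S), and I(V₁;Y₂) > I(V₁;S). Let (R₀,R₁,R₂) be nonnegative reals with R₁ + R₀ ≤ I((V₁,V₂);Y₁) − I((V₁,V₂);S) and R₂ + R₀ ≤ I(V₁;Y₂) − I(V₁;S), and fix β ∈ (0,1/2). Then for every δ > 0 there exist a block length n and an (M₀,M₁,M₂,n) code such that (log₂ Mᵢ)/n ≥ Rᵢ − δ for i = 0,1,2 and P_e ≤ 2^{−n^β}. 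-/
open scoped BigOperators

noncomputable section

/-- A probability mass function on a finite type. -/
def IsPMF {α : Type*} [Fintype α] (p : α → ℝ) : Prop :=
  (∀ a, 0 ≤ p a) ∧ ∑ a, p a = 1

/-- Shannon entropy (base 2), with the convention `0 * log₂ 0 = 0`. -/
def ent {α : Type*} [Fintype α] (p : α → ℝ) : ℝ :=
  -∑ a, p a * Real.logb 2 (p a)

/-- Marginal of a joint pmf on the second component. -/
def margSnd {α β : Type*} [Fintype α] [Fintype β] (p : α × β → ℝ) : β → ℝ :=
  fun b => ∑ a, p (a, b)

/-- Marginal of a joint pmf on the first component. -/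
def margFst {α β : Type*} [Fintype α] [Fintype β] (p : α × β → ℝ) : α → ℝ :=
  fun a => ∑ b, p (a, b)

/-- Conditional entropy H(X|Y) of a joint pmf on α × β
(terms with `p (a, b) = 0` vanish since `0 * log₂ _ = 0`). -/
def condEnt {α β : Type*} [Fintype α] [Fintype β] (p : α × β → ℝ) : ℝ :=
  -∑ a, ∑ b, p (a, b) * Real.logb 2 (p (a, b) / margSnd p b)

/-- Mutual information I(X;Y) = H(X) - H(X|Y) of a joint pmf on α × β. -/
def mutInfo {α β : Type*} [Fintype α] [Fintype β] (p : α × β → ℝ) : ℝ :=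
  ent (margFst p) - condEnt p

/-- Pushforward of a pmf along a map. -/
def pushPMF {α β : Type*} [Fintype α] [DecidableEq β] (p : α → ℝ) (f : α → β) : β → ℝ :=
  fun b => ∑ a, if f a = b then p a else 0

/-- Entropy H(A) of a random variable A on the finite probability space (Ω, p). -/
def entOf {Ω α : Type*} [Fintype Ω] [Fintype α] [DecidableEq α] (p : Ω → ℝ) (A : Ω → α) : ℝ :=
  ent (pushPMF p A)

/-- Conditional entropy H(A|B) of random variables on (Ω, p). -/
def condEntOf {Ω α β : Type*} [Fintype Ω] [Fintype α] [Fintype β] [DecidableEq α] [DecidableEq β]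
    (p : Ω → ℝ) (A : Ω → α) (B : Ω → β) : ℝ :=
  condEnt (pushPMF p (fun ω => (A ω, B ω)))

/-- Mutual information I(A;B) of random variables on (Ω, p). -/
def mutInfoOf {Ω α β : Type*} [Fintype Ω] [Fintype α] [Fintype β] [DecidableEq α] [DecidableEq β]
    (p : Ω → ℝ) (A : Ω → α) (B : Ω → β) : ℝ :=
  entOf p A - condEntOf p A B

/-- Conditional mutual information I(A;B|C) = H(A|C) - H(A|(B,C)). -/
def condMutInfoOf {Ω α β γ : Type*} [Fintype Ω] [Fintype α] [Fintype β] [Fintype γ]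
    [DecidableEq α] [DecidableEq β] [DecidableEq γ]
    (p : Ω → ℝ) (A : Ω → α) (B : Ω → β) (C : Ω → γ) : ℝ :=
  condEntOf p A C - condEntOf p A (fun ω => (B ω, C ω))

/-- Bhattacharyya parameter Z(X|Y) = 2 ∑_y √(p(0,y) p(1,y)) for binary X. -/
def bhat {β : Type*} [Fintype β] (p : ZMod 2 × β → ℝ) : ℝ :=
  2 * ∑ b, Real.sqrt (p (0, b) * p (1, b))

/-- Average error probability of an (M₀,M₁,M₂,n) code for a two-receiver broadcast
channel with receiver message side information and noncausal state: messages are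
uniform, the state sequence is i.i.d. ∼ PS and independent of the messages, the
channel is memoryless, and an error occurs if either decoder fails. -/
def PeBCS {Xc Sc Y1 Y2 : Type*} [Fintype Xc] [Fintype Sc] [Fintype Y1] [Fintype Y2]
    (PS : Sc → ℝ) (W : Xc → Sc → Y1 × Y2 → ℝ) {M0 M1 M2 n : ℕ}
    (enc : Fin M0 × Fin M1 × Fin M2 → (Fin n → Sc) → Fin n → Xc)
    (dec1 : (Fin n → Y1) × Fin M2 → Fin M0 × Fin M1)
    (dec2 : (Fin n → Y2) × Fin M1 → Fin M0 × Fin M2) : ℝ :=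
  (1 / ((M0 : ℝ) * M1 * M2)) * ∑ m : Fin M0 × Fin M1 × Fin M2,
    ∑ s : Fin n → Sc, ∑ y : (Fin n → Y1) × (Fin n → Y2),
      (∏ i, PS (s i)) * (∏ i, W (enc m s i) (s i) (y.1 i, y.2 i)) *
        (if dec1 (y.1, m.2.2) ≠ (m.1, m.2.1) ∨ dec2 (y.2, m.2.1) ≠ (m.1, m.2.2)
          then 1 else 0)

/-- Probability of an event under a finitely supported weight function. -/
def eventProb {α : Type*} [Fintype α] (p : α → ℝ) (s : α → Prop) : ℝ :=
  open scoped Classical in ∑ a, if s a then p a else 0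

section EventProb

variable {α β : Type*} [Fintype α] [Fintype β]

theorem eventProb_nonneg {p : α → ℝ} (hp : ∀ a, 0 ≤ p a) (s : α → Prop) :
    0 ≤ eventProb p s := by
  classical
  unfold eventProb
  exact Finset.sum_nonneg fun a _ => by split_ifs <;> simp [hp a]

theorem eventProb_mono {p : α → ℝ} (hp : ∀ a, 0 ≤ p a) {s t : α → Prop}
    (h : ∀ a, 0 < p a → s a → t a) : eventProb p s ≤ eventProb p t := by
  classical
  unfold eventProb
  refine Finset.sum_le_sum fun a _ => ?_
  rcases (hp a).eq_or_lt with h0 | h0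
  · simp [← h0]
  · have := h a h0
    split_ifs <;> first | exact absurd (this ‹_›) ‹_› | simp [hp a]

theorem eventProb_le_one {p : α → ℝ} (hp : IsPMF p) (s : α → Prop) : eventProb p s ≤ 1 := by
  classical
  rw [← hp.2]
  unfold eventProb
  exact Finset.sum_le_sum fun a _ => by split_ifs <;> simp [hp.1 a]

theorem eventProb_not {p : α → ℝ} (hp : IsPMF p) (s : α → Prop) :
    eventProb p (fun a => ¬ s a) = 1 - eventProb p s := by
  classical
  rw [← hp.2]
  unfold eventProb
  rw [← Finset.sum_sub_distrib]
  exact Finset.sum_congr rfl fun a _ => by by_cases h : s a <;> simp [h]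

theorem eventProb_or_le {p : α → ℝ} (hp : ∀ a, 0 ≤ p a) (s t : α → Prop) :
    eventProb p (fun a => s a ∨ t a) ≤ eventProb p s + eventProb p t := by
  classical
  unfold eventProb
  rw [← Finset.sum_add_distrib]
  refine Finset.sum_le_sum fun a _ => ?_
  have := hp a
  by_cases h : s a <;> by_cases h' : t a <;> simp [h, h', this]

theorem eventProb_exists_le {ι : Type*} [Fintype ι] {p : α → ℝ} (hp : ∀ a, 0 ≤ p a)
    (s : ι → α → Prop) :
    eventProb p (fun a => ∃ i, s i a) ≤ ∑ i, eventProb p (s i) := by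
  classical
  unfold eventProb
  rw [Finset.sum_comm]
  refine Finset.sum_le_sum fun a _ => ?_
  have hn : ∀ i ∈ Finset.univ, 0 ≤ if s i a then p a else 0 := fun i _ => by
    split_ifs <;> simp [hp a]
  split_ifs with h
  · obtain ⟨i, hi⟩ := h
    have := Finset.single_le_sum hn (Finset.mem_univ i)
    simpa [hi] using this
  · exact Finset.sum_nonneg hn

theorem eventProb_eq_sum (p : α → ℝ) (s : α → Prop) [DecidablePred s] :
    eventProb p s = ∑ a, p a * (if s a then 1 else 0) := by
  unfold eventProb
  exact Finset.sum_congr rfl fun a _ => by by_cases h : s a <;> simp [h]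

/-- Markov's inequality. -/
theorem eventProb_lt_le {p g : α → ℝ} (hp : ∀ a, 0 ≤ p a) (hg : ∀ a, 0 ≤ g a) {η : ℝ}
    (hη : 0 < η) : eventProb p (fun a => η < g a) ≤ (∑ a, p a * g a) / η := by
  classical
  rw [le_div_iff₀ hη]
  unfold eventProb
  rw [Finset.sum_mul]
  refine Finset.sum_le_sum fun a _ => ?_
  split_ifs with h
  · exact mul_le_mul_of_nonneg_left h.le (hp a)
  · simpa using mul_nonneg (hp a) (hg a)

theorem eventProb_equiv (e : α ≃ β) (p : β → ℝ) (s : β → Prop) :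
    eventProb p s = eventProb (fun a => p (e a)) (fun a => s (e a)) := by
  classical
  unfold eventProb
  exact (Equiv.sum_comp e _).symm

end EventProb

section ProductPMF

variable {ι α : Type*} [Fintype ι] [DecidableEq ι] [Fintype α]

theorem sum_pi_prod (g : ι → α → ℝ) :
    ∑ x : ι → α, ∏ i, g i (x i) = ∏ i, ∑ a, g i a := by
  rw [Finset.prod_univ_sum, Fintype.piFinset_univ]

theorem IsPMF.pi {p : ι → α → ℝ} (h : ∀ i, IsPMF (p i)) :
    IsPMF (fun x : ι → α => ∏ i, p i (x i)) :=
  ⟨fun x => Finset.prod_nonneg fun i _ => (h i).1 _, by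
    rw [sum_pi_prod]; exact Finset.prod_eq_one fun i _ => (h i).2⟩

theorem sum_pi_prod_mul_eval {p : α → ℝ} (hp : IsPMF p) (g : α → ℝ) (m : ι) :
    ∑ x : ι → α, (∏ i, p (x i)) * g (x m) = ∑ a, p a * g a := by
  have h1 : ∀ x : ι → α, (∏ i, p (x i)) * g (x m)
      = ∏ i, (p (x i) * if i = m then g (x i) else 1) := fun x => by
    rw [Finset.prod_mul_distrib, Finset.prod_ite_eq' Finset.univ m]; simp
  simp_rw [h1]
  rw [sum_pi_prod (fun i a => p a * if i = m then g a else 1),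
    Finset.prod_eq_single m]
  · simp
  · intro i _ hi; simpa [hi] using hp.2
  · simp

theorem sum_pi_prod_mul_eval_mul_eval {p : α → ℝ} (hp : IsPMF p) (g h : α → ℝ) {m m' : ι}
    (hm : m' ≠ m) :
    ∑ x : ι → α, (∏ i, p (x i)) * (g (x m) * h (x m'))
      = (∑ a, p a * g a) * ∑ a, p a * h a := by
  have h1 : ∀ x : ι → α, (∏ i, p (x i)) * (g (x m) * h (x m'))
      = ∏ i, (p (x i) * ((if i = m then g (x i) else 1) * if i = m' then h (x i) else 1)) :=
    fun x => by
      rw [Finset.prod_mul_distrib, Finset.prod_mul_distrib, Finset.prod_ite_eq' Finset.univ m,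
        Finset.prod_ite_eq' Finset.univ m']; simp
  simp_rw [h1]
  rw [sum_pi_prod (fun i a => p a * ((if i = m then g a else 1) * if i = m' then h a else 1))]
  have h2 : ∀ i, ∑ a, p a * ((if i = m then g a else 1) * if i = m' then h a else 1)
      = (if i = m then ∑ a, p a * g a else 1) * (if i = m' then ∑ a, p a * h a else 1) := by
    intro i
    by_cases h3 : i = m
    · subst h3; simp [hm.symm]
    · by_cases h4 : i = m'
      · simp [h4, hm]
      · simpa [h3, h4] using hp.2
  simp_rw [h2]
  rw [Finset.prod_mul_distrib, Finset.prod_ite_eq' Finset.univ m,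
        Finset.prod_ite_eq' Finset.univ m']; simp

theorem eventProb_pi_forall (p : α → ℝ) (s : α → Prop) :
    eventProb (fun x : ι → α => ∏ i, p (x i)) (fun x => ∀ i, s (x i))
      = eventProb p s ^ Fintype.card ι := by
  classical
  unfold eventProb
  have h1 : ∀ x : ι → α, (if ∀ i, s (x i) then ∏ i, p (x i) else 0)
      = ∏ i, if s (x i) then p (x i) else 0 := fun x => by
    split_ifs with h
    · exact Finset.prod_congr rfl fun i _ => by simp [h i]
    · push Not at h
      obtain ⟨i, hi⟩ := h
      exact (Finset.prod_eq_zero (Finset.mem_univ i) (by simp [hi])).symm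
  simp_rw [h1]
  rw [sum_pi_prod (fun _ a => if s a then p a else 0)]
  simp

theorem eventProb_pi_eval {p : α → ℝ} (hp : IsPMF p) (s : α → Prop) (m : ι) :
    eventProb (fun x : ι → α => ∏ i, p (x i)) (fun x => s (x m)) = eventProb p s := by
  classical
  rw [eventProb_eq_sum, eventProb_eq_sum]
  exact sum_pi_prod_mul_eval hp (fun a => if s a then 1 else 0) m

end ProductPMF

theorem IsPMF.exists_le {α : Type*} [Fintype α] {p : α → ℝ} (hp : IsPMF p) {g : α → ℝ} {B : ℝ}
    (h : ∑ a, p a * g a ≤ B) : ∃ a, g a ≤ B := by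
  by_contra! hc
  have h1 : ∑ a, p a * B < ∑ a, p a * g a := by
    refine Finset.sum_lt_sum (fun a _ => mul_le_mul_of_nonneg_left (hc a).le (hp.1 a)) ?_
    by_contra! h2
    have : ∀ a, p a = 0 := fun a => by
      by_contra h3
      exact absurd (mul_lt_mul_of_pos_left (hc a) (lt_of_le_of_ne (hp.1 a) (Ne.symm h3)))
        (not_lt.2 (h2 a (Finset.mem_univ a)))
    have := hp.2
    simp_all
  rw [← Finset.sum_mul, hp.2, one_mul] at h1
  linarith

section RandomCode

variable {ι Row Y Y1 Y2 : Type*} [Fintype ι] [DecidableEq ι] [Fintype Row] [Fintype Y]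
  [Fintype Y1] [Fintype Y2]

theorem sum_iid_eventProb_other_le {R : Row → ℝ} (hR : IsPMF R) {G : Row → Y → ℝ}
    (hG : ∀ r, IsPMF (G r)) (D : Row → Y → Prop) {τ : ℝ}
    (hτ : ∀ y, eventProb R (fun r => D r y) ≤ τ) {m m' : ι} (hm : m' ≠ m) :
    ∑ c : ι → Row, (∏ i, R (c i)) * eventProb (G (c m)) (fun y => D (c m') y) ≤ τ := by
  classical
  simp_rw [eventProb_eq_sum, Finset.mul_sum]
  rw [Finset.sum_comm]
  have h1 : ∀ y, ∑ c : ι → Row, (∏ i, R (c i)) * (G (c m) y * if D (c m') y then 1 else 0)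
      ≤ (∑ r, R r * G r y) * τ := fun y => by
    rw [sum_pi_prod_mul_eval_mul_eval hR (fun r => G r y) (fun r => if D r y then 1 else 0) hm,
      ← eventProb_eq_sum]
    exact mul_le_mul_of_nonneg_left (hτ y)
      (Finset.sum_nonneg fun r _ => mul_nonneg (hR.1 r) ((hG r).1 y))
  refine (Finset.sum_le_sum fun y _ => h1 y).trans_eq ?_
  rw [← Finset.sum_mul, Finset.sum_comm]
  simp_rw [← Finset.mul_sum, fun r => (hG r).2, mul_one, hR.2, one_mul]

/-- A threshold decoder: some message accepted by the test `D`, if there is one. -/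
def thresholdDecoder {μ : Type*} [Nonempty μ] (D : μ → Prop) : μ := Classical.epsilon D

theorem thresholdDecoder_eq {μ : Type*} [Nonempty μ] {D : μ → Prop} {m : μ} (h : D m)
    (h' : ∀ m', m' ≠ m → ¬ D m') : thresholdDecoder D = m := by
  by_contra hne
  exact h' _ hne (Classical.epsilon_spec (p := D) ⟨m, h⟩)

theorem sum_iid_union_le {μ : Type*} [Fintype μ] [DecidableEq μ] {R : Row → ℝ} (hR : IsPMF R)
    {G : Row → Y → ℝ} (hG : ∀ r, IsPMF (G r)) (D : Row → Y → Prop) {τ : ℝ}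
    (hτ : ∀ y, eventProb R (fun r => D r y) ≤ τ) (k : μ → ι) {a : μ}
    (hk : ∀ a', a' ≠ a → k a' ≠ k a) :
    ∑ c : ι → Row, (∏ i, R (c i)) *
        eventProb (G (c (k a))) (fun y => ∃ a' : {a' // a' ≠ a}, D (c (k a')) y)
      ≤ ((Fintype.card μ : ℝ) - 1) * τ := by
  have h1 : ∀ c : ι → Row, (∏ i, R (c i)) *
        eventProb (G (c (k a))) (fun y => ∃ a' : {a' // a' ≠ a}, D (c (k a')) y)
      ≤ ∑ a' : {a' // a' ≠ a}, (∏ i, R (c i)) *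
        eventProb (G (c (k a))) (fun y => D (c (k a')) y) := fun c => by
    rw [← Finset.mul_sum]
    exact mul_le_mul_of_nonneg_left (eventProb_exists_le (hG _).1 _)
      (Finset.prod_nonneg fun i _ => hR.1 _)
  refine (Finset.sum_le_sum fun c _ => h1 c).trans ?_
  rw [Finset.sum_comm]
  refine (Finset.sum_le_sum fun a' _ =>
    sum_iid_eventProb_other_le hR hG D hτ (hk a'.1 a'.2)).trans_eq ?_
  have h2 : Fintype.card {a' // a' ≠ a} = Fintype.card μ - 1 := by
    rw [Fintype.card_subtype_compl]; simp
  have h3 : 1 ≤ Fintype.card μ := Fintype.card_pos_iff.2 ⟨a⟩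
  rw [Finset.sum_const, Finset.card_univ, h2, nsmul_eq_mul, Nat.cast_sub h3, Nat.cast_one]

/-- Random coding: every message triple is assigned an independent row drawn from `R`; each
receiver looks for a message whose row passes its test, among the messages compatible with its
side information. -/
theorem exists_rows_and_decoders {R : Row → ℝ} (hR : IsPMF R) {G : Row → Y1 × Y2 → ℝ}
    (hG : ∀ r, IsPMF (G r)) (D1 : Row → Y1 → Prop) (D2 : Row → Y2 → Prop) {ε τ1 τ2 : ℝ}
    (hτ1 : ∀ y, eventProb R (fun r => D1 r y) ≤ τ1)
    (hτ2 : ∀ y, eventProb R (fun r => D2 r y) ≤ τ2)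
    (hε : ∑ r, R r * eventProb (G r) (fun y => ¬ D1 r y.1 ∨ ¬ D2 r y.2) ≤ ε)
    {M0 M1 M2 : ℕ} (hM0 : 0 < M0) (hM1 : 0 < M1) (hM2 : 0 < M2) :
    ∃ (c : Fin M0 × Fin M1 × Fin M2 → Row) (dec1 : Y1 × Fin M2 → Fin M0 × Fin M1)
      (dec2 : Y2 × Fin M1 → Fin M0 × Fin M2),
      (1 / ((M0 : ℝ) * M1 * M2)) * ∑ m : Fin M0 × Fin M1 × Fin M2, eventProb (G (c m))
        (fun y => dec1 (y.1, m.2.2) ≠ (m.1, m.2.1) ∨ dec2 (y.2, m.2.1) ≠ (m.1, m.2.2))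
      ≤ ε + ((M0 : ℝ) * M1 - 1) * τ1 + ((M0 : ℝ) * M2 - 1) * τ2 := by
  have : NeZero M0 := ⟨hM0.ne'⟩
  have : NeZero M1 := ⟨hM1.ne'⟩
  have : NeZero M2 := ⟨hM2.ne'⟩
  let dec1 : (Fin M0 × Fin M1 × Fin M2 → Row) → Y1 × Fin M2 → Fin M0 × Fin M1 :=
    fun c z => thresholdDecoder fun a => D1 (c (a.1, a.2, z.2)) z.1
  let dec2 : (Fin M0 × Fin M1 × Fin M2 → Row) → Y2 × Fin M1 → Fin M0 × Fin M2 :=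
    fun c z => thresholdDecoder fun a => D2 (c (a.1, z.2, a.2)) z.1
  have hMpos : (0 : ℝ) < (M0 : ℝ) * M1 * M2 := by positivity
  have key : ∀ m : Fin M0 × Fin M1 × Fin M2, ∑ c : Fin M0 × Fin M1 × Fin M2 → Row,
      (∏ i, R (c i)) * eventProb (G (c m)) (fun y => dec1 c (y.1, m.2.2) ≠ (m.1, m.2.1) ∨
        dec2 c (y.2, m.2.1) ≠ (m.1, m.2.2))
      ≤ ε + ((M0 : ℝ) * M1 - 1) * τ1 + ((M0 : ℝ) * M2 - 1) * τ2 := by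
    rintro ⟨m0, m1, m2⟩
    have b1 := sum_iid_union_le hR hG (fun r y => D1 r y.1) (fun y => hτ1 y.1)
      (fun a : Fin M0 × Fin M1 => ((a.1, a.2, m2) : Fin M0 × Fin M1 × Fin M2)) (a := (m0, m1))
      (by rintro ⟨a, a'⟩ h h'; simp_all)
    have b2 := sum_iid_union_le hR hG (fun r y => D2 r y.2) (fun y => hτ2 y.2)
      (fun a : Fin M0 × Fin M2 => ((a.1, m1, a.2) : Fin M0 × Fin M1 × Fin M2)) (a := (m0, m2))
      (by rintro ⟨a, a'⟩ h h'; simp_all)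
    have b0 := sum_pi_prod_mul_eval hR
      (fun r => eventProb (G r) (fun y => ¬ D1 r y.1 ∨ ¬ D2 r y.2))
      ((m0, m1, m2) : Fin M0 × Fin M1 × Fin M2)
    simp only [Fintype.card_prod, Fintype.card_fin, Nat.cast_mul] at b1 b2
    refine le_trans ?_ (add_le_add (add_le_add (b0.le.trans hε) b1) b2)
    rw [← Finset.sum_add_distrib, ← Finset.sum_add_distrib]
    refine Finset.sum_le_sum fun c _ => ?_
    rw [← mul_add, ← mul_add]
    refine mul_le_mul_of_nonneg_left ?_ (Finset.prod_nonneg fun i _ => hR.1 _)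
    refine le_trans ?_ (add_le_add (eventProb_or_le (hG _).1 _ _) le_rfl)
    refine le_trans ?_ (eventProb_or_le (hG _).1 _ _)
    refine eventProb_mono (hG _).1 fun y _ hy => ?_
    by_contra hcon
    push Not at hcon
    obtain ⟨⟨⟨h1, h2⟩, h3⟩, h4⟩ := hcon
    refine hy.elim (fun h => h ?_) (fun h => h ?_)
    · exact thresholdDecoder_eq (m := ((m0, m1) : Fin M0 × Fin M1)) h1 fun a ha => h3 ⟨a, ha⟩
    · exact thresholdDecoder_eq (m := ((m0, m2) : Fin M0 × Fin M2)) h2 fun a ha => h4 ⟨a, ha⟩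
  obtain ⟨c, hc⟩ := (IsPMF.pi (fun _ : Fin M0 × Fin M1 × Fin M2 => hR)).exists_le
    (g := fun c => (1 / ((M0 : ℝ) * M1 * M2)) * ∑ m : Fin M0 × Fin M1 × Fin M2,
      eventProb (G (c m)) (fun y => dec1 c (y.1, m.2.2) ≠ (m.1, m.2.1) ∨
        dec2 c (y.2, m.2.1) ≠ (m.1, m.2.2)))
    (B := ε + ((M0 : ℝ) * M1 - 1) * τ1 + ((M0 : ℝ) * M2 - 1) * τ2) (by
      simp_rw [mul_left_comm _ (1 / ((M0 : ℝ) * M1 * M2)), Finset.mul_sum]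
      rw [Finset.sum_comm]
      simp_rw [← Finset.mul_sum]
      rw [one_div, inv_mul_le_iff₀ hMpos]
      refine (Finset.sum_le_sum fun m _ => key m).trans_eq ?_
      simp only [Finset.sum_const, Finset.card_univ, Fintype.card_prod, Fintype.card_fin,
        nsmul_eq_mul, Nat.cast_mul]
      ring)
  exact ⟨c, dec1 c, dec2 c, hc⟩

end RandomCode

section Covering

theorem one_sub_pow_le {α x g : ℝ} {k : ℕ} (hx : x ≤ 1) (hα0 : 0 ≤ α) (hα : α ≤ 1)
    (h : x / g ≤ α) : (1 - α) ^ k ≤ 1 - x + Real.exp (-(k / g)) := by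
  have hE := (Real.exp_pos (-(k / g))).le
  rcases lt_or_ge x 0 with hx0 | hx0
  · have : (1 - α) ^ k ≤ 1 := pow_le_one₀ (by linarith) (by linarith)
    linarith
  have h1 : 1 - α ≤ Real.exp (-(x / g)) := by
    have := Real.add_one_le_exp (-α)
    have h2 : Real.exp (-α) ≤ Real.exp (-(x / g)) := Real.exp_le_exp.2 (by linarith)
    linarith
  have h2 : (1 - α) ^ k ≤ Real.exp (x * -(k / g)) := by
    refine (pow_le_pow_left₀ (by linarith) h1 k).trans_eq ?_
    rw [← Real.exp_nat_mul]; congr 1; ring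
  have h3 := convexOn_exp.2 (Set.mem_univ 0) (Set.mem_univ (-(k / g))) (sub_nonneg.2 hx) hx0
    (by ring)
  simp only [smul_eq_mul, mul_zero, zero_add, Real.exp_zero, mul_one] at h3
  nlinarith

variable {V T S : Type*} [Fintype V] [Fintype T] [Fintype S]

/-- Distribution of a superposition cell: a cloud centre drawn from `P` together with a family of
satellites drawn independently from `K v`. -/
def cellPMF {κ : Type*} [Fintype κ] (P : V → ℝ) (K : V → T → ℝ) (z : V × (κ → T)) : ℝ :=
  P z.1 * ∏ k, K z.1 (z.2 k)

variable {κ ι : Type*} [Fintype κ] [DecidableEq κ] [Fintype ι] [DecidableEq ι]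

theorem cellPMF_isPMF {P : V → ℝ} {K : V → T → ℝ} (hP : IsPMF P) (hK : ∀ v, IsPMF (K v)) :
    IsPMF (cellPMF (κ := κ) P K) := by
  refine ⟨fun z => mul_nonneg (hP.1 _) (Finset.prod_nonneg fun k _ => (hK _).1 _), ?_⟩
  unfold cellPMF
  rw [Fintype.sum_prod_type]
  simp_rw [← Finset.mul_sum]
  simp_rw [fun v => (IsPMF.pi (fun _ : κ => hK v)).2, mul_one, hP.2]

theorem eventProb_cellPMF (P : V → ℝ) (K : V → T → ℝ) (s : V → (κ → T) → Prop) :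
    eventProb (cellPMF P K) (fun z => s z.1 z.2)
      = ∑ v, P v * eventProb (fun t : κ → T => ∏ k, K v (t k)) (s v) := by
  classical
  unfold eventProb cellPMF
  rw [Fintype.sum_prod_type]
  refine Finset.sum_congr rfl fun v _ => ?_
  rw [Finset.mul_sum]
  exact Finset.sum_congr rfl fun t _ => by split_ifs <;> simp

theorem eventProb_le_mul {p q : T → ℝ} {g : ℝ} {A : T → Prop}
    (h : ∀ t, A t → p t ≤ g * q t) : eventProb p A ≤ g * eventProb q A := by
  classical
  unfold eventProb
  rw [Finset.mul_sum]
  refine Finset.sum_le_sum fun t _ => ?_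
  split_ifs with ht
  · exact h t ht
  · simp

/-- Superposition covering: the probability that no pair (cloud centre, satellite) of a random row
lies in `A`. -/
theorem eventProb_not_covered_le {P : V → ℝ} {K : V → T → ℝ} (hP : IsPMF P)
    (hK : ∀ v, IsPMF (K v)) {qv : V → ℝ} {qt : V → T → ℝ} (hqv : IsPMF qv)
    (hqt : ∀ v, IsPMF (qt v)) {g1 g2 : ℝ} (hg1 : 0 < g1) (hg2 : 0 < g2) {A : V → T → Prop}
    (hA : ∀ v t, A v t → qv v ≤ g1 * P v ∧ qt v t ≤ g2 * K v t) :
    eventProb (fun r : ι → V × (κ → T) => ∏ i, cellPMF P K (r i))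
        (fun r => ∀ i k, ¬ A (r i).1 ((r i).2 k))
      ≤ (1 - ∑ v, qv v * eventProb (qt v) (A v)) + Real.exp (-(Fintype.card κ / g2))
        + Real.exp (-(Fintype.card ι / g1)) := by
  set e2 := Real.exp (-(Fintype.card κ / g2)) with he2
  have he2' : 0 ≤ e2 := (Real.exp_pos _).le
  rw [eventProb_pi_forall (cellPMF P K) (fun z : V × (κ → T) => ∀ k, ¬ A z.1 (z.2 k)),
    eventProb_cellPMF P K (fun v (t : κ → T) => ∀ k, ¬ A v (t k))]
  set u : V → ℝ := fun v => (1 - eventProb (K v) (A v)) ^ Fintype.card κ with hu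
  have h1 : ∀ v, eventProb (fun t : κ → T => ∏ k, K v (t k)) (fun t => ∀ k, ¬ A v (t k)) = u v :=
    fun v => by rw [eventProb_pi_forall (K v) (fun t => ¬ A v t), eventProb_not (hK v)]
  simp_rw [h1]
  have hu0 : ∀ v, 0 ≤ u v := fun v => pow_nonneg (by linarith [eventProb_le_one (hK v) (A v)]) _
  have hu1 : ∀ v, u v ≤ 1 := fun v => pow_le_one₀ (by linarith [eventProb_le_one (hK v) (A v)])
    (by linarith [eventProb_nonneg (hK v).1 (A v)])
  have hux : ∀ v, u v ≤ 1 - eventProb (qt v) (A v) + e2 := fun v =>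
    one_sub_pow_le (eventProb_le_one (hqt v) _) (eventProb_nonneg (hK v).1 _)
      (eventProb_le_one (hK v) _)
      ((div_le_iff₀' hg2).2 (eventProb_le_mul fun t ht => (hA v t ht).2))
  have h2 : ∑ v, P v * u v = 1 - ∑ v, P v * (1 - u v) := by
    simp_rw [mul_sub, mul_one]; rw [Finset.sum_sub_distrib, hP.2]; ring
  have h3 : (∑ v, qv v * eventProb (qt v) (A v) - e2) / g1 ≤ ∑ v, P v * (1 - u v) := by
    rw [div_le_iff₀' hg1, Finset.mul_sum]
    have : ∑ v, qv v * eventProb (qt v) (A v) - e2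
        = ∑ v, qv v * (eventProb (qt v) (A v) - e2) := by
      simp_rw [mul_sub]; rw [Finset.sum_sub_distrib, ← Finset.sum_mul, hqv.2, one_mul]
    rw [this]
    refine Finset.sum_le_sum fun v _ => ?_
    by_cases hv : qv v ≤ g1 * P v
    · have a1 := mul_le_mul_of_nonneg_right hv (sub_nonneg.2 (hu1 v))
      have a2 := mul_le_mul_of_nonneg_left
        (show eventProb (qt v) (A v) - e2 ≤ 1 - u v by linarith [hux v]) (hqv.1 v)
      linarith
    · have : eventProb (qt v) (A v) ≤ 0 := by
        classical
        unfold eventProb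
        exact (Finset.sum_eq_zero fun t _ => by
          rw [if_neg fun ht => hv (hA v t ht).1]).le
      have a1 := mul_nonneg (mul_nonneg hg1.le (hP.1 v)) (sub_nonneg.2 (hu1 v))
      have a2 := mul_nonneg (hqv.1 v)
        (show 0 ≤ -(eventProb (qt v) (A v) - e2) by linarith)
      linarith
  rw [h2]
  have h4 : ∑ v, qv v * eventProb (qt v) (A v) ≤ 1 := by
    rw [← hqv.2]
    exact Finset.sum_le_sum fun v _ => mul_le_of_le_one_right (hqv.1 v)
      (eventProb_le_one (hqt v) _)
  have h5 : 0 ≤ ∑ v, P v * (1 - u v) :=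
    Finset.sum_nonneg fun v _ => mul_nonneg (hP.1 v) (sub_nonneg.2 (hu1 v))
  have h6 : ∑ v, P v * (1 - u v) ≤ 1 := by
    exact (Finset.sum_le_sum fun v _ => mul_le_of_le_one_right (hP.1 v)
      (by linarith [hu0 v])).trans_eq hP.2
  have := one_sub_pow_le (k := Fintype.card ι) (by linarith) h5 h6 h3
  linarith


theorem eventProb_channel {Z Y : Type*} [Fintype Z] [Fintype Y] (J : Z → ℝ) (N : Z → Y → ℝ)
    (p : Z → Y → Prop) :
    eventProb (fun ω : Z × Y => J ω.1 * N ω.1 ω.2) (fun ω => p ω.1 ω.2)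
      = ∑ z, J z * eventProb (N z) (p z) := by
  classical
  unfold eventProb
  rw [Fintype.sum_prod_type]
  refine Finset.sum_congr rfl fun z _ => ?_
  rw [Finset.mul_sum]
  exact Finset.sum_congr rfl fun y _ => by split_ifs <;> simp

theorem eventProb_channel_input {Z Y : Type*} [Fintype Z] [Fintype Y] (J : Z → ℝ)
    {N : Z → Y → ℝ} (hN : ∀ z, IsPMF (N z)) (p : Z → Prop) :
    eventProb (fun ω : Z × Y => J ω.1 * N ω.1 ω.2) (fun ω => p ω.1) = eventProb J p := by
  classical
  rw [eventProb_channel J N (fun z _ => p z)]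
  unfold eventProb
  refine Finset.sum_congr rfl fun z _ => ?_
  by_cases h : p z <;> simp [h, (hN z).2]

theorem eventProb_mixture {Z Y : Type*} [Fintype Z] [Fintype Y] (J : Z → ℝ) (N : Z → Y → ℝ)
    (p : Y → Prop) :
    eventProb (fun y => ∑ z, J z * N z y) p = ∑ z, J z * eventProb (N z) p := by
  classical
  unfold eventProb
  simp_rw [Finset.mul_sum]
  rw [Finset.sum_comm]
  refine Finset.sum_congr rfl fun y _ => ?_
  split_ifs <;> simp

/-- Joint distribution of auxiliary variables and state, built from the conditional distributions
given the state. -/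
def auxPMF (PS : S → ℝ) (qv : S → V → ℝ) (qt : S → V → T → ℝ) (z : V × T × S) : ℝ :=
  PS z.2.2 * qv z.2.2 z.1 * qt z.2.2 z.1 z.2.1

theorem eventProb_auxPMF (PS : S → ℝ) (qv : S → V → ℝ) (qt : S → V → T → ℝ)
    (p : V → T → S → Prop) :
    eventProb (auxPMF PS qv qt) (fun z => p z.1 z.2.1 z.2.2)
      = ∑ s, PS s * ∑ v, qv s v * eventProb (qt s v) (fun t => p v t s) := by
  classical
  unfold eventProb auxPMF
  rw [Fintype.sum_prod_type]
  simp_rw [Fintype.sum_prod_type, Finset.mul_sum]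
  rw [Finset.sum_comm (s := (Finset.univ : Finset S))]
  refine Finset.sum_congr rfl fun v _ => ?_
  rw [Finset.sum_comm]
  refine Finset.sum_congr rfl fun s _ => Finset.sum_congr rfl fun t _ => ?_
  split_ifs
  · ring
  · simp

theorem auxPMF_isPMF {PS : S → ℝ} {qv : S → V → ℝ} {qt : S → V → T → ℝ} (hPS : IsPMF PS)
    (hqv : ∀ s, IsPMF (qv s)) (hqt : ∀ s v, IsPMF (qt s v)) : IsPMF (auxPMF PS qv qt) := by
  refine ⟨fun z => mul_nonneg (mul_nonneg (hPS.1 _) ((hqv _).1 _)) ((hqt _ _).1 _), ?_⟩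
  have := eventProb_auxPMF PS qv qt (fun _ _ _ => True)
  simp only [eventProb, if_true] at this
  simp_rw [fun s v => (hqt s v).2, mul_one, fun s => (hqv s).2, mul_one, hPS.2] at this
  exact this

variable {X Y1 Y2 : Type*} [Fintype Y1] [Fintype Y2]

/-- One-shot Gelfand-Pinsker coding bound with superposition: there are codes whose error
probability is controlled by the tails of the four information densities. -/
theorem exists_code_one_shot [Nonempty ι] [Nonempty κ] {PS : S → ℝ} (hPS : IsPMF PS)
    {W : X → S → Y1 × Y2 → ℝ} (hW : ∀ x s, IsPMF (W x s)) (f : V → T → S → X)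
    {P : V → ℝ} {K : V → T → ℝ} (hP : IsPMF P) (hK : ∀ v, IsPMF (K v))
    {qv : S → V → ℝ} {qt : S → V → T → ℝ} (hqv : ∀ s, IsPMF (qv s))
    (hqt : ∀ s v, IsPMF (qt s v)) {g1 g2 : ℝ} (hg1 : 0 < g1) (hg2 : 0 < g2)
    {η τ1 τ2 : ℝ} (hη : 0 < η) (G1 : V → T → Y1 → Prop) (G2 : V → Y2 → Prop)
    (hG1 : ∀ y, ∑ v, P v * eventProb (K v) (fun t => G1 v t y) ≤ τ1)
    (hG2 : ∀ y, eventProb P (fun v => G2 v y) ≤ τ2)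
    {Q : (V × T × S) × (Y1 × Y2) → ℝ}
    (hQ : ∀ ω, Q ω = auxPMF PS qv qt ω.1 * W (f ω.1.1 ω.1.2.1 ω.1.2.2) ω.1.2.2 ω.2)
    {M0 M1 M2 : ℕ} (hM0 : 0 < M0) (hM1 : 0 < M1) (hM2 : 0 < M2) :
    ∃ (enc : Fin M0 × Fin M1 × Fin M2 → S → X) (dec1 : Y1 × Fin M2 → Fin M0 × Fin M1)
      (dec2 : Y2 × Fin M1 → Fin M0 × Fin M2),
      (1 / ((M0 : ℝ) * M1 * M2)) * ∑ m : Fin M0 × Fin M1 × Fin M2, ∑ s, PS s *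
        eventProb (W (enc m s) s)
        (fun y => dec1 (y.1, m.2.2) ≠ (m.1, m.2.1) ∨ dec2 (y.2, m.2.1) ≠ (m.1, m.2.2))
      ≤ (eventProb Q (fun ω => g1 * P ω.1.1 < qv ω.1.2.2 ω.1.1)
          + eventProb Q (fun ω => g2 * K ω.1.1 ω.1.2.1 < qt ω.1.2.2 ω.1.1 ω.1.2.1)
          + (eventProb Q (fun ω => ¬ G1 ω.1.1 ω.1.2.1 ω.2.1)
            + eventProb Q (fun ω => ¬ G2 ω.1.1 ω.2.2)) / η
          + Real.exp (-(Fintype.card κ / g2)) + Real.exp (-(Fintype.card ι / g1)) + η)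
        + ((M0 : ℝ) * M1 - 1) * (Fintype.card ι * Fintype.card κ * τ1)
        + ((M0 : ℝ) * M2 - 1) * (Fintype.card ι * τ2) := by
  classical
  obtain rfl : Q = fun ω => auxPMF PS qv qt ω.1 * W (f ω.1.1 ω.1.2.1 ω.1.2.2) ω.1.2.2 ω.2 :=
    funext hQ
  let bad : V × T × S → ℝ := fun z =>
    eventProb (W (f z.1 z.2.1 z.2.2) z.2.2) (fun y => ¬ G1 z.1 z.2.1 y.1 ∨ ¬ G2 z.1 y.2)
  let A : V → T → S → Prop := fun v t s =>
    qv s v ≤ g1 * P v ∧ qt s v t ≤ g2 * K v t ∧ bad (v, t, s) ≤ η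
  let pick : (ι → V × (κ → T)) → S → ι × κ := fun r s =>
    Classical.epsilon fun p => A (r p.1).1 ((r p.1).2 p.2) s
  let e : (ι → V × (κ → T)) → S → X := fun r s =>
    f (r (pick r s).1).1 ((r (pick r s).1).2 (pick r s).2) s
  let R : (ι → V × (κ → T)) → ℝ := fun r => ∏ i, cellPMF P K (r i)
  have hcell : IsPMF (cellPMF (κ := κ) P K) := cellPMF_isPMF hP hK
  have hR : IsPMF R := IsPMF.pi fun _ => hcell
  have hJ : IsPMF (auxPMF PS qv qt) := auxPMF_isPMF hPS hqv hqt
  have hG : ∀ r, IsPMF (fun y => ∑ s, PS s * W (e r s) s y) := fun r =>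
    ⟨fun y => Finset.sum_nonneg fun s _ => mul_nonneg (hPS.1 s) ((hW _ _).1 y), by
      rw [Finset.sum_comm]
      simp_rw [← Finset.mul_sum, fun s => (hW (e r s) s).2, mul_one, hPS.2]⟩
  let D1 : (ι → V × (κ → T)) → Y1 → Prop := fun r y => ∃ p : ι × κ, G1 (r p.1).1 ((r p.1).2 p.2) y
  let D2 : (ι → V × (κ → T)) → Y2 → Prop := fun r y => ∃ i, G2 (r i).1 y
  have hτ1 : ∀ y, eventProb R (fun r => D1 r y) ≤ Fintype.card ι * Fintype.card κ * τ1 := by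
    intro y
    refine (eventProb_exists_le hR.1 _).trans ?_
    refine (Finset.sum_le_sum (g := fun _ => τ1) fun p _ => ?_).trans_eq ?_
    · refine le_trans (le_of_eq ?_) (hG1 y)
      rw [eventProb_pi_eval hcell (fun z => G1 z.1 (z.2 p.2) y) p.1,
        eventProb_cellPMF P K (fun v (t : κ → T) => G1 v (t p.2) y)]
      exact Finset.sum_congr rfl fun v _ => by
        rw [eventProb_pi_eval (hK v) (fun t => G1 v t y) p.2]
    · simp [Finset.card_univ]
  have hτ2 : ∀ y, eventProb R (fun r => D2 r y) ≤ Fintype.card ι * τ2 := by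
    intro y
    refine (eventProb_exists_le hR.1 _).trans ?_
    refine (Finset.sum_le_sum (g := fun _ => τ2) fun i _ => ?_).trans_eq ?_
    · refine le_trans (le_of_eq ?_) (hG2 y)
      rw [eventProb_pi_eval hcell (fun z => G2 z.1 y) i,
        eventProb_cellPMF P K (fun v _ => G2 v y), eventProb_eq_sum]
      refine Finset.sum_congr rfl fun v _ => ?_
      have := (IsPMF.pi fun _ : κ => hK v).2
      by_cases h : G2 v y <;> simp [eventProb, h, this]
    · simp [Finset.card_univ]
  have hbad : ∀ r s, eventProb (W (e r s) s) (fun y => ¬ D1 r y.1 ∨ ¬ D2 r y.2)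
      ≤ (if ∀ i k, ¬ A (r i).1 ((r i).2 k) s then 1 else 0) + η := by
    intro r s
    split_ifs with h
    · linarith [eventProb_le_one (hW (e r s) s) (fun y => ¬ D1 r y.1 ∨ ¬ D2 r y.2)]
    · push Not at h
      obtain ⟨i, k, hik⟩ := h
      have hA := Classical.epsilon_spec
        (p := fun p : ι × κ => A (r p.1).1 ((r p.1).2 p.2) s) ⟨(i, k), hik⟩
      rw [zero_add]
      refine le_trans (eventProb_mono (hW _ _).1 fun y _ hy => ?_) hA.2.2
      exact hy.imp (fun h1 h2 => h1 ⟨_, h2⟩) (fun h1 h2 => h1 ⟨_, h2⟩)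
  have hcov : ∀ s, eventProb R (fun r => ∀ i k, ¬ A (r i).1 ((r i).2 k) s)
      ≤ (1 - ∑ v, qv s v * eventProb (qt s v) (fun t => A v t s))
        + Real.exp (-(Fintype.card κ / g2)) + Real.exp (-(Fintype.card ι / g1)) := fun s =>
    eventProb_not_covered_le (A := fun v t => A v t s) hP hK (hqv s) (hqt s) hg1 hg2
      fun v t h => ⟨h.1, h.2.1⟩
  have hAJ : 1 - ∑ s, PS s * ∑ v, qv s v * eventProb (qt s v) (fun t => A v t s)
      ≤ eventProb (auxPMF PS qv qt) (fun z => g1 * P z.1 < qv z.2.2 z.1)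
        + eventProb (auxPMF PS qv qt) (fun z => g2 * K z.1 z.2.1 < qt z.2.2 z.1 z.2.1)
        + (∑ z, auxPMF PS qv qt z * bad z) / η := by
    rw [← eventProb_auxPMF PS qv qt A, ← eventProb_not hJ]
    refine le_trans ?_ (add_le_add (eventProb_or_le hJ.1 _ _)
      (eventProb_lt_le hJ.1 (fun z => eventProb_nonneg (hW _ _).1 _) hη))
    refine le_trans ?_ (eventProb_or_le hJ.1 _ _)
    refine eventProb_mono hJ.1 fun z _ hz => ?_
    by_contra hcon
    push Not at hcon
    exact hz ⟨hcon.1.1, hcon.1.2, hcon.2⟩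
  have hbadQ : ∑ z, auxPMF PS qv qt z * bad z
      ≤ ∑ z, auxPMF PS qv qt z * eventProb (W (f z.1 z.2.1 z.2.2) z.2.2)
          (fun y => ¬ G1 z.1 z.2.1 y.1)
        + ∑ z, auxPMF PS qv qt z * eventProb (W (f z.1 z.2.1 z.2.2) z.2.2)
          (fun y => ¬ G2 z.1 y.2) := by
    rw [← Finset.sum_add_distrib]
    refine Finset.sum_le_sum fun z _ => ?_
    rw [← mul_add]
    exact mul_le_mul_of_nonneg_left (eventProb_or_le (hW _ _).1 _ _) (hJ.1 z)
  have hε : ∑ r, R r * eventProb (fun y => ∑ s, PS s * W (e r s) s y)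
        (fun y => ¬ D1 r y.1 ∨ ¬ D2 r y.2)
      ≤ (1 - ∑ s, PS s * ∑ v, qv s v * eventProb (qt s v) (fun t => A v t s))
        + Real.exp (-(Fintype.card κ / g2)) + Real.exp (-(Fintype.card ι / g1)) + η := by
    simp_rw [eventProb_mixture PS (fun s y => W (e _ s) s y)]
    have step : ∀ r, R r * ∑ s, PS s * eventProb (W (e r s) s) (fun y => ¬ D1 r y.1 ∨ ¬ D2 r y.2)
        ≤ ∑ s, (PS s * (R r * if ∀ i k, ¬ A (r i).1 ((r i).2 k) s then 1 else 0)
          + PS s * (R r * η)) := fun r => by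
      rw [Finset.mul_sum]
      refine Finset.sum_le_sum fun s _ => ?_
      have := mul_le_mul_of_nonneg_left (hbad r s) (mul_nonneg (hR.1 r) (hPS.1 s))
      linarith
    refine (Finset.sum_le_sum fun r _ => step r).trans ?_
    rw [Finset.sum_comm]
    simp_rw [Finset.sum_add_distrib, ← Finset.mul_sum, ← Finset.sum_mul, hPS.2, hR.2, one_mul]
    gcongr
    have h2 : ∀ s, PS s * ∑ r, (R r * if ∀ i k, ¬ A (r i).1 ((r i).2 k) s then 1 else 0)
        ≤ PS s * ((1 - ∑ v, qv s v * eventProb (qt s v) (fun t => A v t s))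
        + Real.exp (-(Fintype.card κ / g2)) + Real.exp (-(Fintype.card ι / g1))) := fun s => by
      rw [← eventProb_eq_sum]
      exact mul_le_mul_of_nonneg_left (hcov s) (hPS.1 s)
    refine (Finset.sum_le_sum fun s _ => h2 s).trans_eq ?_
    simp_rw [mul_add, mul_sub, mul_one]
    simp_rw [Finset.sum_add_distrib, Finset.sum_sub_distrib, ← Finset.sum_mul, hPS.2, one_mul]
  obtain ⟨c, dec1, dec2, hc⟩ := exists_rows_and_decoders hR hG D1 D2 hτ1 hτ2 hε hM0 hM1 hM2
  refine ⟨fun m => e (c m), dec1, dec2, ?_⟩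
  simp_rw [eventProb_mixture PS (fun s y => W (e _ s) s y)] at hc
  refine hc.trans ?_
  have N := fun z : V × T × S => hW (f z.1 z.2.1 z.2.2) z.2.2
  rw [eventProb_channel_input _ N (fun z => g1 * P z.1 < qv z.2.2 z.1),
    eventProb_channel_input _ N (fun z => g2 * K z.1 z.2.1 < qt z.2.2 z.1 z.2.1),
    eventProb_channel _ (fun z : V × T × S => W (f z.1 z.2.1 z.2.2) z.2.2)
      (fun z y => ¬ G1 z.1 z.2.1 y.1),
    eventProb_channel _ (fun z : V × T × S => W (f z.1 z.2.1 z.2.2) z.2.2)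
      (fun z y => ¬ G2 z.1 y.2)]
  have := div_le_div_of_nonneg_right hbadQ hη.le
  gcongr
  linarith

end Covering

section Chernoff

theorem exists_sum_mul_exp_lt_one {Ω : Type*} [Fintype Ω] {p : Ω → ℝ} (hp : IsPMF p)
    {h : Ω → ℝ} (hh : ∑ ω, p ω * h ω < 0) :
    ∃ t : ℝ, 0 < t ∧ ∑ ω, p ω * Real.exp (t * h ω) < 1 := by
  have hd : HasDerivAt (fun t : ℝ => ∑ ω, p ω * Real.exp (t * h ω)) (∑ ω, p ω * h ω) 0 := by
    refine HasDerivAt.fun_sum fun ω _ => ?_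
    have h1 : HasDerivAt (fun t : ℝ => t * h ω) (h ω) 0 := by
      simpa using (hasDerivAt_id (0 : ℝ)).mul_const (h ω)
    simpa using (h1.exp).const_mul (p ω)
  have h0 := hd.tendsto_slope_zero_right.eventually_lt_const hh
  obtain ⟨t, ht, ht0⟩ := (h0.and self_mem_nhdsWithin).exists
  refine ⟨t, ht0, ?_⟩
  have ht0' : (0 : ℝ) < t := ht0
  simp only [zero_add, zero_mul, Real.exp_zero, mul_one, hp.2, smul_eq_mul] at ht
  have := (inv_mul_lt_iff₀ ht0').1 ht
  linarith

/-- Chernoff bound for the likelihood ratio of product weights. -/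
theorem exists_ratio_tail_le {Ω : Type*} [Fintype Ω] {q a b : Ω → ℝ} (hq : IsPMF q)
    (ha : ∀ ω, 0 < q ω → 0 < a ω) (hb : ∀ ω, 0 < q ω → 0 < b ω) {c : ℝ}
    (hc : ∑ ω, q ω * Real.logb 2 (a ω / b ω) < c) :
    ∃ ρ : ℝ, 0 < ρ ∧ ρ < 1 ∧ ∀ n : ℕ, eventProb (fun ω : Fin n → Ω => ∏ i, q (ω i))
      (fun ω => ((2 : ℝ) ^ c) ^ n * ∏ i, b (ω i) < ∏ i, a (ω i)) ≤ ρ ^ n := by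
  classical
  obtain ⟨t, ht, hρ⟩ := exists_sum_mul_exp_lt_one hq
    (h := fun ω => Real.logb 2 (a ω / b ω) - c) (by
      simp_rw [mul_sub]
      rw [Finset.sum_sub_distrib, ← Finset.sum_mul, hq.2]; linarith)
  set g : Ω → ℝ := fun ω => q ω * Real.exp (t * (Real.logb 2 (a ω / b ω) - c)) with hg
  have hg0 : ∀ ω, 0 ≤ g ω := fun ω => mul_nonneg (hq.1 ω) (Real.exp_pos _).le
  refine ⟨∑ ω, g ω, ?_, hρ, fun n => ?_⟩
  · obtain ⟨ω, hω⟩ : ∃ ω, 0 < q ω := by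
      by_contra! h
      have := Finset.sum_nonpos fun ω (_ : ω ∈ Finset.univ) => h ω
      linarith [hq.2]
    exact Finset.sum_pos' (fun ω _ => hg0 ω) ⟨ω, Finset.mem_univ _, mul_pos hω (Real.exp_pos _)⟩
  have h1 : (∑ ω, g ω) ^ n = ∑ ω : Fin n → Ω, ∏ i, g (ω i) := by
    rw [sum_pi_prod (fun _ => g)]; simp
  rw [h1]
  unfold eventProb
  refine Finset.sum_le_sum fun ω _ => ?_
  have hn : 0 ≤ ∏ i, g (ω i) := Finset.prod_nonneg fun i _ => hg0 _
  split_ifs with h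
  swap
  · exact hn
  by_cases hz : ∃ i, q (ω i) = 0
  · obtain ⟨i, hi⟩ := hz
    exact (Finset.prod_eq_zero (f := fun i => q (ω i)) (Finset.mem_univ i) hi).trans_le hn
  push Not at hz
  have hpos : ∀ i, 0 < q (ω i) := fun i => lt_of_le_of_ne (hq.1 _) (Ne.symm (hz i))
  simp_rw [hg]
  rw [Finset.prod_mul_distrib, ← Real.exp_sum]
  refine le_mul_of_one_le_right (Finset.prod_nonneg fun i _ => hq.1 _) (Real.one_le_exp ?_)
  rw [← Finset.mul_sum]
  refine mul_nonneg ht.le ?_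
  have hB : 0 < ∏ i, b (ω i) := Finset.prod_pos fun i _ => hb _ (hpos i)
  have hA : 0 < ∏ i, a (ω i) := Finset.prod_pos fun i _ => ha _ (hpos i)
  have h2 : ∑ i, Real.logb 2 (a (ω i) / b (ω i))
      = Real.logb 2 (∏ i, a (ω i)) - Real.logb 2 (∏ i, b (ω i)) := by
    rw [Real.logb_prod _ _ fun i _ => (ha _ (hpos i)).ne',
      Real.logb_prod _ _ fun i _ => (hb _ (hpos i)).ne', ← Finset.sum_sub_distrib]
    exact Finset.sum_congr rfl fun i _ =>
      Real.logb_div (ha _ (hpos i)).ne' (hb _ (hpos i)).ne'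
  have h3 := Real.logb_lt_logb (b := 2) (by norm_num) (by positivity) h
  rw [Real.logb_mul (by positivity) hB.ne', Real.logb_pow,
    Real.logb_rpow (by norm_num) (by norm_num)] at h3
  rw [Finset.sum_sub_distrib, h2]
  simp only [Finset.sum_const, Finset.card_univ, Fintype.card_fin, nsmul_eq_mul]
  linarith

theorem sum_mul_logb_nonneg {Ω : Type*} [Fintype Ω] {q a b : Ω → ℝ} (hq : IsPMF q)
    (ha : ∀ ω, 0 < q ω → 0 < a ω) (hb : ∀ ω, 0 < q ω → 0 < b ω)
    (h : ∑ ω, q ω * (b ω / a ω) ≤ 1) : 0 ≤ ∑ ω, q ω * Real.logb 2 (a ω / b ω) := by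
  have hl : 0 < Real.log 2 := Real.log_pos (by norm_num)
  have h1 : ∀ ω, q ω * (1 - b ω / a ω) / Real.log 2 ≤ q ω * Real.logb 2 (a ω / b ω) := by
    intro ω
    rcases (hq.1 ω).eq_or_lt with h0 | h0
    · simp [← h0]
    have hr : 0 < a ω / b ω := div_pos (ha ω h0) (hb ω h0)
    have := Real.one_sub_inv_le_log_of_pos hr
    rw [inv_div] at this
    rw [Real.logb, mul_div_assoc]
    exact mul_le_mul_of_nonneg_left (div_le_div_of_nonneg_right this hl.le) h0.le
  refine le_trans ?_ (Finset.sum_le_sum fun ω _ => h1 ω)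
  rw [← Finset.sum_div]
  refine div_nonneg ?_ hl.le
  simp_rw [mul_sub, mul_one]
  rw [Finset.sum_sub_distrib, hq.2]
  linarith

end Chernoff

section Conditional

variable {Ω α β : Type*} [Fintype Ω] [DecidableEq α] [DecidableEq β]

theorem pushPMF_pos {q : Ω → ℝ} (hq : IsPMF q) (A : Ω → α) {ω : Ω} (h : 0 < q ω) :
    0 < pushPMF q A (A ω) := by
  refine Finset.sum_pos' (fun ω _ => by split_ifs <;> simp [hq.1 ω]) ⟨ω, Finset.mem_univ _, ?_⟩
  simpa using h

theorem pushPMF_eq_of_iff (q : Ω → ℝ) (A : Ω → α) (B : Ω → β) {a : α} {b : β}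
    (h : ∀ ω, A ω = a ↔ B ω = b) : pushPMF q A a = pushPMF q B b := by
  unfold pushPMF
  exact Finset.sum_congr rfl fun ω _ => by simp [h ω]

variable [Fintype α]

theorem sum_pushPMF_pair (q : Ω → ℝ) (A : Ω → α) (B : Ω → β) (b : β) :
    ∑ a, pushPMF q (fun ω => (A ω, B ω)) (a, b) = pushPMF q B b := by
  unfold pushPMF
  rw [Finset.sum_comm]
  refine Finset.sum_congr rfl fun ω _ => ?_
  by_cases h : B ω = b <;> simp [h]

theorem sum_pushPMF_mul (q : Ω → ℝ) (A : Ω → α) (g : α → ℝ) :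
    ∑ a, pushPMF q A a * g a = ∑ ω, q ω * g (A ω) := by
  unfold pushPMF
  simp_rw [Finset.sum_mul]
  rw [Finset.sum_comm]
  exact Finset.sum_congr rfl fun ω _ => by simp

theorem pushPMF_isPMF {q : Ω → ℝ} (hq : IsPMF q) (A : Ω → α) : IsPMF (pushPMF q A) := by
  refine ⟨fun a => Finset.sum_nonneg fun ω _ => by split_ifs <;> simp [hq.1 ω], ?_⟩
  have := sum_pushPMF_mul q A (fun _ => 1)
  simpa [hq.2] using this

/-- Conditional pmf of `A` given `B = b`; uniform when `B = b` has probability zero. -/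
def condPMF (q : Ω → ℝ) (A : Ω → α) (B : Ω → β) (b : β) (a : α) : ℝ :=
  if pushPMF q B b = 0 then (Fintype.card α : ℝ)⁻¹
  else pushPMF q (fun ω => (A ω, B ω)) (a, b) / pushPMF q B b

theorem condPMF_eq_div {q : Ω → ℝ} (hq : IsPMF q) (A : Ω → α) (B : Ω → β) {ω : Ω}
    (h : 0 < q ω) : condPMF q A B (B ω) (A ω)
      = pushPMF q (fun ω => (A ω, B ω)) (A ω, B ω) / pushPMF q B (B ω) := by
  unfold condPMF
  rw [if_neg (pushPMF_pos hq B h).ne']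

theorem condPMF_pos {q : Ω → ℝ} (hq : IsPMF q) (A : Ω → α) (B : Ω → β) {ω : Ω}
    (h : 0 < q ω) : 0 < condPMF q A B (B ω) (A ω) := by
  rw [condPMF_eq_div hq A B h]
  exact div_pos (pushPMF_pos hq (fun ω => (A ω, B ω)) h) (pushPMF_pos hq B h)

variable [Fintype β]

theorem condPMF_isPMF [Nonempty α] {q : Ω → ℝ} (hq : IsPMF q) (A : Ω → α) (B : Ω → β) (b : β) :
    IsPMF (condPMF q A B b) := by
  unfold condPMF
  by_cases h : pushPMF q B b = 0
  · simp only [h, if_true]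
    refine ⟨fun a => by positivity, ?_⟩
    simp [Finset.card_univ]
  · simp only [h, if_false]
    refine ⟨fun a => div_nonneg ((pushPMF_isPMF hq _).1 _) ((pushPMF_isPMF hq _).1 _), ?_⟩
    rw [← Finset.sum_div, sum_pushPMF_pair, div_self h]

theorem pushPMF_mul_condPMF {q : Ω → ℝ} (hq : IsPMF q) (A : Ω → α) (B : Ω → β) (b : β) (a : α) :
    pushPMF q B b * condPMF q A B b a = pushPMF q (fun ω => (A ω, B ω)) (a, b) := by
  unfold condPMF
  split_ifs with h
  · have h1 := sum_pushPMF_pair q A B b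
    rw [h, Finset.sum_eq_zero_iff_of_nonneg fun a _ => (pushPMF_isPMF hq _).1 _] at h1
    rw [h, zero_mul, h1 a (Finset.mem_univ a)]
  · field_simp

theorem mutInfoOf_eq_sum {q : Ω → ℝ} (hq : IsPMF q) (A : Ω → α) (B : Ω → β) :
    mutInfoOf q A B
      = ∑ ω, q ω * Real.logb 2 (condPMF q A B (B ω) (A ω) / pushPMF q A (A ω)) := by
  have h1 : entOf q A = -∑ ω, q ω * Real.logb 2 (pushPMF q A (A ω)) := by
    rw [entOf, ent, sum_pushPMF_mul q A fun a => Real.logb 2 (pushPMF q A a)]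
  have h2 : condEntOf q A B = -∑ ω, q ω * Real.logb 2
      (pushPMF q (fun ω => (A ω, B ω)) (A ω, B ω) / pushPMF q B (B ω)) := by
    rw [condEntOf, condEnt, ← Fintype.sum_prod_type', ← sum_pushPMF_mul q (fun ω => (A ω, B ω))
      fun z => Real.logb 2 (pushPMF q (fun ω => (A ω, B ω)) z / pushPMF q B z.2)]
    have h3 : ∀ b, margSnd (pushPMF q fun ω => (A ω, B ω)) b = pushPMF q B b :=
      sum_pushPMF_pair q A B
    simp_rw [h3]
  rw [mutInfoOf, h1, h2, neg_sub_neg, ← Finset.sum_sub_distrib]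
  refine Finset.sum_congr rfl fun ω _ => ?_
  rw [← mul_sub]
  rcases (hq.1 ω).eq_or_lt with h0 | h0
  · simp [← h0]
  rw [← condPMF_eq_div hq A B h0,
    Real.logb_div (condPMF_pos hq A B h0).ne' (pushPMF_pos hq A h0).ne']

/-- Expected conditional information density is nonnegative. -/
theorem sum_mul_logb_condPMF_nonneg [Nonempty α] {q : Ω → ℝ} (hq : IsPMF q) (A : Ω → α)
    (B : Ω → β) {r : β → α → ℝ} (hr : ∀ b, IsPMF (r b)) (hpos : ∀ ω, 0 < q ω → 0 < r (B ω) (A ω)) :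
    0 ≤ ∑ ω, q ω * Real.logb 2 (condPMF q A B (B ω) (A ω) / r (B ω) (A ω)) := by
  refine sum_mul_logb_nonneg hq (fun ω => condPMF_pos hq A B) hpos ?_
  rw [← sum_pushPMF_mul q (fun ω => (A ω, B ω)) (fun z => r z.2 z.1 / condPMF q A B z.2 z.1)]
  have h1 : ∀ z : α × β, pushPMF q (fun ω => (A ω, B ω)) z * (r z.2 z.1 / condPMF q A B z.2 z.1)
      ≤ pushPMF q B z.2 * r z.2 z.1 := by
    rintro ⟨a, b⟩
    rw [← pushPMF_mul_condPMF hq A B b a]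
    have hB := (pushPMF_isPMF hq B).1 b
    have hr' := (hr b).1 a
    rcases ((condPMF_isPMF hq A B b).1 a).eq_or_lt with h0 | h0
    · simp only [← h0]; simpa using mul_nonneg hB hr'
    · simp only
      rw [mul_assoc, mul_div_cancel₀ _ h0.ne']
  refine (Finset.sum_le_sum fun z _ => h1 z).trans_eq ?_
  rw [Fintype.sum_prod_type, Finset.sum_comm]
  simp_rw [← Finset.mul_sum, fun b => (hr b).2, mul_one, (pushPMF_isPMF hq B).2]

end Conditional

section BlockCode

theorem IsPMF.pi_pair {ι α β : Type*} [Fintype ι] [DecidableEq ι] [Fintype α] [Fintype β]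
    {p : ι → α × β → ℝ} (h : ∀ i, IsPMF (p i)) :
    IsPMF (fun z : (ι → α) × (ι → β) => ∏ i, p i (z.1 i, z.2 i)) := by
  refine ⟨fun z => Finset.prod_nonneg fun i _ => (h i).1 _, ?_⟩
  rw [← (IsPMF.pi h).2]
  exact (Equiv.sum_comp (Equiv.arrowProdEquivProdArrow ι (fun _ => α) (fun _ => β))
    (fun z => ∏ i, p i (z.1 i, z.2 i))).symm

/-- Regrouping a sequence of joint symbols into a tuple of sequences. -/
def unzipEquiv (n : ℕ) (V T S Y1 Y2 : Type*) : (Fin n → (V × T × S) × (Y1 × Y2)) ≃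
    ((Fin n → V) × (Fin n → T) × (Fin n → S)) × ((Fin n → Y1) × (Fin n → Y2)) where
  toFun ω := ((fun i => (ω i).1.1, fun i => (ω i).1.2.1, fun i => (ω i).1.2.2),
    (fun i => (ω i).2.1, fun i => (ω i).2.2))
  invFun z i := ((z.1.1 i, z.1.2.1 i, z.1.2.2 i), (z.2.1 i, z.2.2 i))
  left_inv _ := rfl
  right_inv _ := rfl

variable {V T X S Y1 Y2 : Type*} [Fintype V] [Fintype T] [Fintype X] [Fintype S] [Fintype Y1]
  [Fintype Y2]

/-- Block coding bound: if the four information densities have tails at most `ρ i ^ n`, the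
error probability of a suitable block code is controlled by the codebook sizes. -/
theorem exists_block_code {PS : S → ℝ} (hPS : IsPMF PS) {W : X → S → Y1 × Y2 → ℝ}
    (hW : ∀ x s, IsPMF (W x s)) (f : V → T → S → X) {P : V → ℝ} {K : V → T → ℝ}
    (hP : IsPMF P) (hK : ∀ v, IsPMF (K v)) {qv : S → V → ℝ} {qt : S → V → T → ℝ}
    (hqv : ∀ s, IsPMF (qv s)) (hqt : ∀ s v, IsPMF (qt s v))
    {k1 : Y1 → V × T → ℝ} (hk1 : ∀ y, IsPMF (k1 y)) {k2 : Y2 → V → ℝ} (hk2 : ∀ y, IsPMF (k2 y))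
    {q : (V × T × S) × (Y1 × Y2) → ℝ}
    (hq : ∀ ω, q ω = auxPMF PS qv qt ω.1 * W (f ω.1.1 ω.1.2.1 ω.1.2.2) ω.1.2.2 ω.2)
    {n : ℕ} {g1 g2 g3 g4 η ε1 ε2 ε3 ε4 : ℝ} (hg1 : 0 < g1) (hg2 : 0 < g2) (hg3 : 0 < g3)
    (hg4 : 0 < g4) (hη : 0 < η)
    (h1 : eventProb (fun ω : Fin n → _ => ∏ i, q (ω i))
      (fun ω => g1 * ∏ i, P (ω i).1.1 < ∏ i, qv (ω i).1.2.2 (ω i).1.1) ≤ ε1)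
    (h2 : eventProb (fun ω : Fin n → _ => ∏ i, q (ω i))
      (fun ω => g2 * ∏ i, K (ω i).1.1 (ω i).1.2.1 <
        ∏ i, qt (ω i).1.2.2 (ω i).1.1 (ω i).1.2.1) ≤ ε2)
    (h3 : eventProb (fun ω : Fin n → _ => ∏ i, q (ω i))
      (fun ω => g3 * ∏ i, k1 (ω i).2.1 ((ω i).1.1, (ω i).1.2.1) <
        ∏ i, (P (ω i).1.1 * K (ω i).1.1 (ω i).1.2.1)) ≤ ε3)
    (h4 : eventProb (fun ω : Fin n → _ => ∏ i, q (ω i))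
      (fun ω => g4 * ∏ i, k2 (ω i).2.2 (ω i).1.1 < ∏ i, P (ω i).1.1) ≤ ε4)
    {L1 L2 M0 M1 M2 : ℕ} (hL1 : 0 < L1) (hL2 : 0 < L2) (hM0 : 0 < M0) (hM1 : 0 < M1)
    (hM2 : 0 < M2) :
    ∃ (enc : Fin M0 × Fin M1 × Fin M2 → (Fin n → S) → Fin n → X)
      (dec1 : (Fin n → Y1) × Fin M2 → Fin M0 × Fin M1)
      (dec2 : (Fin n → Y2) × Fin M1 → Fin M0 × Fin M2),
      PeBCS PS W enc dec1 dec2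
      ≤ (ε1 + ε2 + (ε3 + ε4) / η + Real.exp (-(L2 / g2)) + Real.exp (-(L1 / g1)) + η)
        + ((M0 : ℝ) * M1 - 1) * (L1 * L2 * g3) + ((M0 : ℝ) * M2 - 1) * (L1 * g4) := by
  classical
  have : NeZero L1 := ⟨hL1.ne'⟩
  have : NeZero L2 := ⟨hL2.ne'⟩
  have hG1 : ∀ y : Fin n → Y1, ∑ v : Fin n → V, (∏ i, P (v i)) *
      eventProb (fun t : Fin n → T => ∏ i, K (v i) (t i))
        (fun t => ∏ i, (P (v i) * K (v i) (t i)) ≤ g3 * ∏ i, k1 (y i) (v i, t i)) ≤ g3 := by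
    intro y
    have hk := (IsPMF.pi_pair fun i => hk1 (y i)).2
    have : g3 = ∑ z : (Fin n → V) × (Fin n → T), g3 * ∏ i, k1 (y i) (z.1 i, z.2 i) := by
      rw [← Finset.mul_sum, hk, mul_one]
    conv_rhs => rw [this, Fintype.sum_prod_type]
    refine Finset.sum_le_sum fun v _ => ?_
    unfold eventProb
    rw [Finset.mul_sum]
    refine Finset.sum_le_sum fun t _ => ?_
    split_ifs with h
    · rwa [← Finset.prod_mul_distrib]
    · rw [mul_zero]
      exact mul_nonneg hg3.le (Finset.prod_nonneg fun i _ => (hk1 _).1 _)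
  have hG2 : ∀ y : Fin n → Y2, eventProb (fun v : Fin n → V => ∏ i, P (v i))
      (fun v => ∏ i, P (v i) ≤ g4 * ∏ i, k2 (y i) (v i)) ≤ g4 := by
    intro y
    have hk := (IsPMF.pi fun i => hk2 (y i)).2
    have : g4 = ∑ v : Fin n → V, g4 * ∏ i, k2 (y i) (v i) := by
      rw [← Finset.mul_sum, hk, mul_one]
    conv_rhs => rw [this]
    unfold eventProb
    refine Finset.sum_le_sum fun v _ => ?_
    split_ifs with h
    · exact h
    · exact mul_nonneg hg4.le (Finset.prod_nonneg fun i _ => (hk2 _).1 _)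
  obtain ⟨enc, dec1, dec2, hcode⟩ := exists_code_one_shot (ι := Fin L1) (κ := Fin L2)
    (PS := fun s : Fin n → S => ∏ i, PS (s i)) (IsPMF.pi fun _ => hPS)
    (W := fun (x : Fin n → X) (s : Fin n → S) (y : (Fin n → Y1) × (Fin n → Y2)) =>
      ∏ i, W (x i) (s i) (y.1 i, y.2 i)) (fun x s => IsPMF.pi_pair fun i => hW (x i) (s i))
    (fun (v : Fin n → V) (t : Fin n → T) (s : Fin n → S) i => f (v i) (t i) (s i))
    (P := fun v => ∏ i, P (v i)) (K := fun v t => ∏ i, K (v i) (t i))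
    (IsPMF.pi fun _ => hP) (fun v => IsPMF.pi fun i => hK (v i))
    (qv := fun s v => ∏ i, qv (s i) (v i)) (qt := fun s v t => ∏ i, qt (s i) (v i) (t i))
    (fun s => IsPMF.pi fun i => hqv (s i)) (fun s v => IsPMF.pi fun i => hqt (s i) (v i))
    hg1 hg2 hη
    (fun v t y => ∏ i, (P (v i) * K (v i) (t i)) ≤ g3 * ∏ i, k1 (y i) (v i, t i))
    (fun v y => ∏ i, P (v i) ≤ g4 * ∏ i, k2 (y i) (v i)) hG1 hG2
    (Q := fun z => ∏ i, q ((z.1.1 i, z.1.2.1 i, z.1.2.2 i), (z.2.1 i, z.2.2 i)))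
    (fun z => by simp only [hq, auxPMF, Finset.prod_mul_distrib]) hM0 hM1 hM2
  refine ⟨enc, dec1, dec2, ?_⟩
  have hPe : PeBCS PS W enc dec1 dec2 = (1 / ((M0 : ℝ) * M1 * M2)) *
      ∑ m : Fin M0 × Fin M1 × Fin M2, ∑ s : Fin n → S, (∏ i, PS (s i)) *
        eventProb (fun y : (Fin n → Y1) × (Fin n → Y2) => ∏ i, W (enc m s i) (s i) (y.1 i, y.2 i))
        (fun y => dec1 (y.1, m.2.2) ≠ (m.1, m.2.1) ∨ dec2 (y.2, m.2.1) ≠ (m.1, m.2.2)) := by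
    unfold PeBCS
    congr 1
    refine Finset.sum_congr rfl fun m _ => Finset.sum_congr rfl fun s _ => ?_
    rw [eventProb_eq_sum, Finset.mul_sum]
    refine Finset.sum_congr rfl fun y _ => ?_
    rw [mul_assoc]
  rw [hPe]
  refine hcode.trans ?_
  simp only [Fintype.card_fin]
  rw [eventProb_equiv (unzipEquiv n V T S Y1 Y2), eventProb_equiv (unzipEquiv n V T S Y1 Y2),
    eventProb_equiv (unzipEquiv n V T S Y1 Y2), eventProb_equiv (unzipEquiv n V T S Y1 Y2)]
  simp only [not_le]
  gcongr
  · exact h1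
  · exact h2
  · exact h3
  · exact h4

end BlockCode

section Rates

theorem exists_mul_pow_le_two_rpow {ρ C b : ℝ} (hρ0 : 0 < ρ) (hρ1 : ρ < 1) (hC : 0 < C)
    (hb : b < 1) : ∃ n : ℕ, 0 < n ∧ C * ρ ^ n ≤ Real.rpow 2 (-(Real.rpow (n : ℝ) b)) := by
  have hl : 0 < -Real.log ρ := by linarith [Real.log_neg hρ0 hρ1]
  have h1 : Filter.Tendsto (fun n : ℕ => (n : ℝ) ^ (-(1 - b)) * Real.log 2 + Real.log C / n)
      Filter.atTop (nhds (0 * Real.log 2 + 0)) :=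
    (((tendsto_rpow_neg_atTop (by linarith)).comp tendsto_natCast_atTop_atTop).mul_const _).add
      (tendsto_const_div_atTop_nhds_zero_nat _)
  rw [zero_mul, zero_add] at h1
  obtain ⟨n, hn, hn0⟩ := ((h1.eventually_lt_const hl).and (Filter.eventually_gt_atTop 0)).exists
  refine ⟨n, hn0, ?_⟩
  have hn' : (0 : ℝ) < n := by exact_mod_cast hn0
  change C * ρ ^ n ≤ (2 : ℝ) ^ (-((n : ℝ) ^ b))
  rw [← Real.log_le_log_iff (by positivity) (by positivity), Real.log_mul hC.ne' (by positivity),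
    Real.log_pow, Real.log_rpow (by norm_num)]
  have h2 : (n : ℝ) ^ (-(1 - b)) = (n : ℝ) ^ b / n := by
    rw [show -(1 - b) = b - 1 by ring, Real.rpow_sub_one hn'.ne']
  rw [h2] at hn
  have h3 := mul_lt_mul_of_pos_left hn hn'
  have h4 : (n : ℝ) * ((n : ℝ) ^ b / n * Real.log 2 + Real.log C / n)
      = (n : ℝ) ^ b * Real.log 2 + Real.log C := by field_simp
  linarith

/-- Number of codewords of rate `e` and block length `n`. -/
def codeSize (e : ℝ) (n : ℕ) : ℕ := ⌈((2 : ℝ) ^ e) ^ n⌉₊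

theorem codeSize_pos (e : ℝ) (n : ℕ) : 0 < codeSize e n := Nat.ceil_pos.2 (by positivity)

theorem pow_le_codeSize (e : ℝ) (n : ℕ) : ((2 : ℝ) ^ e) ^ n ≤ codeSize e n := Nat.le_ceil _

theorem codeSize_le {e : ℝ} (he : 0 ≤ e) (n : ℕ) : (codeSize e n : ℝ) ≤ 2 * ((2 : ℝ) ^ e) ^ n := by
  have h1 : (1 : ℝ) ≤ ((2 : ℝ) ^ e) ^ n := one_le_pow₀ (Real.one_le_rpow (by norm_num) he)
  have := Nat.ceil_lt_add_one (show 0 ≤ ((2 : ℝ) ^ e) ^ n by positivity)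
  unfold codeSize
  linarith

theorem le_logb_codeSize (e : ℝ) {n : ℕ} (hn : 0 < n) :
    e ≤ Real.logb 2 (codeSize e n) / n := by
  have hn' : (0 : ℝ) < n := by exact_mod_cast hn
  rw [le_div_iff₀ hn']
  have := Real.logb_le_logb_of_le (b := 2) (by norm_num) (by positivity) (pow_le_codeSize e n)
  rw [Real.logb_pow, Real.logb_rpow (by norm_num) (by norm_num)] at this
  linarith

theorem codeSize_mul_codeSize_sub_one_le {R R' δ : ℝ} (hR : 0 ≤ R) (hR' : 0 ≤ R') (hδ : 0 ≤ δ)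
    (n : ℕ) : (codeSize (max (R - δ) 0) n : ℝ) * codeSize (max (R' - δ) 0) n - 1
      ≤ 4 * ((2 : ℝ) ^ (R + R' - δ)) ^ n := by
  have h0 : 0 ≤ 4 * ((2 : ℝ) ^ (R + R' - δ)) ^ n := by positivity
  by_cases h : R - δ ≤ 0 ∧ R' - δ ≤ 0
  · rw [max_eq_right h.1, max_eq_right h.2]
    simpa [codeSize] using h0
  have h1 : max (R - δ) 0 + max (R' - δ) 0 ≤ R + R' - δ := by
    rcases le_total (R - δ) 0 with h2 | h2 <;> rcases le_total (R' - δ) 0 with h3 | h3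
    · exact absurd ⟨h2, h3⟩ h
    all_goals simp only [max_eq_left, max_eq_right, h2, h3]; linarith
  have h2 := mul_le_mul (codeSize_le (le_max_right (R - δ) 0) n)
    (codeSize_le (le_max_right (R' - δ) 0) n) (by positivity) (by positivity)
  have h3 : ((2 : ℝ) ^ (max (R - δ) 0 + max (R' - δ) 0)) ^ n ≤ ((2 : ℝ) ^ (R + R' - δ)) ^ n :=
    pow_le_pow_left₀ (by positivity) (Real.rpow_le_rpow_of_exponent_le (by norm_num) h1) n
  rw [Real.rpow_add (by norm_num), mul_pow] at h3
  linarith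

theorem exp_neg_codeSize_div_le (I ε : ℝ) (n : ℕ) :
    Real.exp (-(codeSize (I + 2 * ε) n / ((2 : ℝ) ^ (I + ε)) ^ n)) ≤ ((2 : ℝ) ^ (-ε)) ^ n := by
  have h1 : ((2 : ℝ) ^ ε) ^ n ≤ codeSize (I + 2 * ε) n / ((2 : ℝ) ^ (I + ε)) ^ n := by
    rw [le_div_iff₀ (by positivity), ← mul_pow, ← Real.rpow_add (by norm_num)]
    exact (le_of_eq (by ring_nf)).trans (pow_le_codeSize (I + 2 * ε) n)
  have h2 : ((2 : ℝ) ^ (-ε)) ^ n = (((2 : ℝ) ^ ε) ^ n)⁻¹ := by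
    rw [Real.rpow_neg (by norm_num), inv_pow]
  have hpos : 0 < ((2 : ℝ) ^ ε) ^ n := by positivity
  rw [h2, Real.exp_neg]
  refine inv_anti₀ hpos (h1.trans ?_)
  linarith [Real.add_one_le_exp (codeSize (I + 2 * ε) n / ((2 : ℝ) ^ (I + ε)) ^ n : ℝ)]

theorem two_rpow_pow_mul (x y : ℝ) (n : ℕ) :
    ((2 : ℝ) ^ x) ^ n * ((2 : ℝ) ^ y) ^ n = ((2 : ℝ) ^ (x + y)) ^ n := by
  rw [← mul_pow, ← Real.rpow_add (by norm_num)]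

theorem two_rpow_pow_le {x y : ℝ} (h : x ≤ y) (n : ℕ) :
    ((2 : ℝ) ^ x) ^ n ≤ ((2 : ℝ) ^ y) ^ n :=
  pow_le_pow_left₀ (by positivity) (Real.rpow_le_rpow_of_exponent_le (by norm_num) h) n

/-- Union bound over the (cloud centre, satellite) pairs of all wrong messages. -/
theorem message_mul_rows_le {R R' δ I1 I2 I3 : ℝ} (hR : 0 ≤ R) (hR' : 0 ≤ R') (hδ : 0 < δ)
    (hI1 : 0 ≤ I1) (hI2 : 0 ≤ I2) (h : R + R' ≤ I3 - (I1 + I2)) (n : ℕ) :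
    ((codeSize (max (R - δ) 0) n : ℝ) * codeSize (max (R' - δ) 0) n - 1) *
      (codeSize (I1 + 2 * (δ / 8)) n * codeSize (I2 + 2 * (δ / 8)) n *
        ((2 : ℝ) ^ (-I3 + δ / 8)) ^ n) ≤ 16 * ((2 : ℝ) ^ (-(δ / 8))) ^ n := by
  have a1 := codeSize_mul_codeSize_sub_one_le hR hR' hδ.le n
  have a2 := codeSize_le (show 0 ≤ I1 + 2 * (δ / 8) by positivity) n
  have a3 := codeSize_le (show 0 ≤ I2 + 2 * (δ / 8) by positivity) n
  have a4 := mul_le_mul a2 a3 (by positivity) (by positivity)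
  have a5 := mul_le_mul_of_nonneg_right a4
    (show 0 ≤ ((2 : ℝ) ^ (-I3 + δ / 8)) ^ n by positivity)
  refine (mul_le_mul a1 a5 (by positivity) (by positivity)).trans ?_
  refine le_trans (le_of_eq ?_) (mul_le_mul_of_nonneg_left (two_rpow_pow_le (x := (R + R' - δ) +
    ((I1 + 2 * (δ / 8)) + (I2 + 2 * (δ / 8)) + (-I3 + δ / 8))) (by linarith) n) (by norm_num))
  simp only [← two_rpow_pow_mul]
  ring

/-- Union bound over the cloud centres of all wrong messages. -/
theorem message_mul_clouds_le {R R' δ I1 I4 : ℝ} (hR : 0 ≤ R) (hR' : 0 ≤ R') (hδ : 0 < δ)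
    (hI1 : 0 ≤ I1) (h : R + R' ≤ I4 - I1) (n : ℕ) :
    ((codeSize (max (R - δ) 0) n : ℝ) * codeSize (max (R' - δ) 0) n - 1) *
      (codeSize (I1 + 2 * (δ / 8)) n * ((2 : ℝ) ^ (-I4 + δ / 8)) ^ n)
      ≤ 8 * ((2 : ℝ) ^ (-(δ / 8))) ^ n := by
  have a1 := codeSize_mul_codeSize_sub_one_le hR hR' hδ.le n
  have a2 := codeSize_le (show 0 ≤ I1 + 2 * (δ / 8) by positivity) n
  have a5 := mul_le_mul_of_nonneg_right a2
    (show 0 ≤ ((2 : ℝ) ^ (-I4 + δ / 8)) ^ n by positivity)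
  refine (mul_le_mul a1 a5 (by positivity) (by positivity)).trans ?_
  refine le_trans (le_of_eq ?_) (mul_le_mul_of_nonneg_left (two_rpow_pow_le (x := (R + R' - δ) +
    ((I1 + 2 * (δ / 8)) + (-I4 + δ / 8))) (by linarith) n) (by norm_num))
  simp only [← two_rpow_pow_mul]
  ring

end Rates

/-- achievable rate region of BCSI with common message and noncausal
state, via polar codes: given binary auxiliaries (V₁,V₂) jointly distributed with S,
a function f with X = f(V₁,V₂,S), and the stated strict information inequalities, any
nonnegative rate triple with R₁+R₀ ≤ I((V₁,V₂);Y₁) − I((V₁,V₂);S) and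
R₂+R₀ ≤ I(V₁;Y₂) − I(V₁;S) is achievable with error probability at most 2^{-n^β}. -/
theorem bcsi_noncausal_state_achievable
    {Xc Sc Y1 Y2 : Type*} [Fintype Xc] [Fintype Sc] [Fintype Y1] [Fintype Y2]
    [DecidableEq Sc] [DecidableEq Y1] [DecidableEq Y2]
    (PS : Sc → ℝ) (hPS : IsPMF PS)
    (W : Xc → Sc → Y1 × Y2 → ℝ) (hW : ∀ x s, IsPMF (W x s))
    (PV : ZMod 2 × ZMod 2 × Sc → ℝ) (hPV : IsPMF PV)
    (hmarg : ∀ s, ∑ v1 : ZMod 2, ∑ v2 : ZMod 2, PV (v1, v2, s) = PS s)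
    (f : ZMod 2 → ZMod 2 → Sc → Xc)
    -- the joint pmf of (V₁, V₂, S, Y₁, Y₂)
    (q : (ZMod 2 × ZMod 2 × Sc) × (Y1 × Y2) → ℝ)
    (hq : q = fun ω => PV ω.1 * W (f ω.1.1 ω.1.2.1 ω.1.2.2) ω.1.2.2 ω.2)
    -- condition (3): I(V₂;Y₁|V₁) > I(V₂;S|V₁)
    (h3 : condMutInfoOf q (fun ω => ω.1.2.1) (fun ω => ω.1.2.2) (fun ω => ω.1.1) <
      condMutInfoOf q (fun ω => ω.1.2.1) (fun ω => ω.2.1) (fun ω => ω.1.1))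
    -- condition (4): I(V₁;Y₁) > I(V₁;S)
    (h4 : mutInfoOf q (fun ω => ω.1.1) (fun ω => ω.1.2.2) <
      mutInfoOf q (fun ω => ω.1.1) (fun ω => ω.2.1))
    -- condition (5): I(V₁;Y₂) > I(V₁;S)
    (h5 : mutInfoOf q (fun ω => ω.1.1) (fun ω => ω.1.2.2) <
      mutInfoOf q (fun ω => ω.1.1) (fun ω => ω.2.2))
    (R0 R1 R2 : ℝ) (hR0 : 0 ≤ R0) (hR1 : 0 ≤ R1) (hR2 : 0 ≤ R2)
    (h1 : R1 + R0 ≤ mutInfoOf q (fun ω => (ω.1.1, ω.1.2.1)) (fun ω => ω.2.1)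
        - mutInfoOf q (fun ω => (ω.1.1, ω.1.2.1)) (fun ω => ω.1.2.2))
    (h2 : R2 + R0 ≤ mutInfoOf q (fun ω => ω.1.1) (fun ω => ω.2.2)
        - mutInfoOf q (fun ω => ω.1.1) (fun ω => ω.1.2.2))
    (b : ℝ) (hb0 : 0 < b) (hb : b < 1 / 2) :
    ∀ δ > 0, ∃ (n M0 M1 M2 : ℕ)
      (enc : Fin M0 × Fin M1 × Fin M2 → (Fin n → Sc) → Fin n → Xc)
      (dec1 : (Fin n → Y1) × Fin M2 → Fin M0 × Fin M1)
      (dec2 : (Fin n → Y2) × Fin M1 → Fin M0 × Fin M2),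
      0 < n ∧ 0 < M0 ∧ 0 < M1 ∧ 0 < M2 ∧
      R0 - δ ≤ Real.logb 2 M0 / n ∧
      R1 - δ ≤ Real.logb 2 M1 / n ∧
      R2 - δ ≤ Real.logb 2 M2 / n ∧
      PeBCS PS W enc dec1 dec2 ≤ Real.rpow 2 (-(Real.rpow (n : ℝ) b)) := by
  classical
  intro δ hδ
  have hqfac : ∀ ω, q ω = PV ω.1 * W (f ω.1.1 ω.1.2.1 ω.1.2.2) ω.1.2.2 ω.2 := fun ω => by rw [hq]
  have hN := fun z : ZMod 2 × ZMod 2 × Sc => hW (f z.1 z.2.1 z.2.2) z.2.2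
  have hqP : IsPMF q := by
    refine ⟨fun ω => by rw [hqfac]; exact mul_nonneg (hPV.1 _) ((hW _ _).1 _), ?_⟩
    simp_rw [hqfac]
    rw [Fintype.sum_prod_type]
    simp_rw [← Finset.mul_sum, fun z => (hN z).2, mul_one, hPV.2]
  clear hq
  let V := fun ω : (ZMod 2 × ZMod 2 × Sc) × (Y1 × Y2) => ω.1.1
  let T := fun ω : (ZMod 2 × ZMod 2 × Sc) × (Y1 × Y2) => ω.1.2.1
  let S := fun ω : (ZMod 2 × ZMod 2 × Sc) × (Y1 × Y2) => ω.1.2.2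
  let Z1 := fun ω : (ZMod 2 × ZMod 2 × Sc) × (Y1 × Y2) => ω.2.1
  let Z2 := fun ω : (ZMod 2 × ZMod 2 × Sc) × (Y1 × Y2) => ω.2.2
  let VS := fun ω : (ZMod 2 × ZMod 2 × Sc) × (Y1 × Y2) => (V ω, S ω)
  let VT := fun ω : (ZMod 2 × ZMod 2 × Sc) × (Y1 × Y2) => (V ω, T ω)
  have hpush : ∀ z, pushPMF q (fun ω => ω.1) z = PV z := fun z => by
    have : pushPMF q (fun ω => ω.1) z = eventProb q (fun ω => ω.1 = z) := by
      unfold pushPMF eventProb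
      exact Finset.sum_congr rfl fun ω _ => by split_ifs <;> rfl
    rw [this, show q = _ from funext hqfac,
      eventProb_channel_input PV hN (fun z' => z' = z)]
    unfold eventProb
    exact (Finset.sum_eq_single z (fun x _ hx => if_neg hx) (by simp)).trans (if_pos rfl)
  have hS : ∀ s, pushPMF q S s = PS s := fun s => by
    rw [← hmarg s, ← sum_pushPMF_pair q V S s]
    refine Finset.sum_congr rfl fun v _ => ?_
    rw [← sum_pushPMF_pair q T VS (v, s)]
    refine Finset.sum_congr rfl fun t _ => ?_
    rw [← hpush (v, t, s)]
    refine pushPMF_eq_of_iff q _ _ fun ω => ?_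
    simp only [T, VS, V, S, Prod.ext_iff]
    tauto
  have hVT : ∀ v t, pushPMF q V v * condPMF q T V v t = pushPMF q VT (v, t) := fun v t => by
    rw [pushPMF_mul_condPMF hqP]
    refine pushPMF_eq_of_iff q _ _ fun ω => ?_
    simp only [VT, Prod.ext_iff]
    tauto
  have haux : ∀ ω, q ω = auxPMF PS (condPMF q V S) (fun s v => condPMF q T VS (v, s)) ω.1 *
      W (f ω.1.1 ω.1.2.1 ω.1.2.2) ω.1.2.2 ω.2 := fun ω => by
    rw [hqfac, auxPMF, ← hS, pushPMF_mul_condPMF hqP]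
    have : pushPMF q VS (ω.1.1, ω.1.2.2) * condPMF q T VS (ω.1.1, ω.1.2.2) ω.1.2.1 = PV ω.1 := by
      rw [pushPMF_mul_condPMF hqP, ← hpush]
      refine pushPMF_eq_of_iff q _ _ fun ω' => ?_
      simp only [T, VS, V, S, Prod.ext_iff]
      tauto
    rw [← this]
  have hPpos : ∀ ω, 0 < q ω → 0 < pushPMF q V (V ω) := fun ω => pushPMF_pos hqP V
  have hKpos : ∀ ω, 0 < q ω → 0 < condPMF q T V (V ω) (T ω) := fun ω => condPMF_pos hqP T V
  set I1 := ∑ ω, q ω * Real.logb 2 (condPMF q V S (S ω) (V ω) / pushPMF q V (V ω)) with hI1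
  set I2 := ∑ ω, q ω * Real.logb 2 (condPMF q T VS (VS ω) (T ω) / condPMF q T V (V ω) (T ω))
    with hI2
  have hI1nn : 0 ≤ I1 := sum_mul_logb_condPMF_nonneg hqP V S (r := fun _ => pushPMF q V)
    (fun _ => pushPMF_isPMF hqP V) hPpos
  have hI2nn : 0 ≤ I2 := sum_mul_logb_condPMF_nonneg hqP T VS
    (r := fun z => condPMF q T V z.1) (fun z => condPMF_isPMF hqP T V z.1) hKpos
  have hVS : mutInfoOf q V S = I1 := mutInfoOf_eq_sum hqP V S
  have hVTS : mutInfoOf q VT S = I1 + I2 := by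
    rw [mutInfoOf_eq_sum hqP VT S, hI1, hI2, ← Finset.sum_add_distrib]
    refine Finset.sum_congr rfl fun ω _ => ?_
    rw [← mul_add]
    rcases (hqP.1 ω).eq_or_lt with h0 | h0
    · simp [← h0]
    have p1 := condPMF_pos hqP V S h0
    have p2 := hPpos ω h0
    have p3 := condPMF_pos hqP T VS h0
    have p4 := hKpos ω h0
    have p5 := pushPMF_pos hqP S h0
    rw [← Real.logb_mul (div_pos p1 p2).ne' (div_pos p3 p4).ne']
    congr 2
    have e1 : condPMF q VT S (S ω) (VT ω)
        = condPMF q V S (S ω) (V ω) * condPMF q T VS (VS ω) (T ω) := by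
      have d1 := pushPMF_mul_condPMF hqP VT S (S ω) (VT ω)
      have d2 := pushPMF_mul_condPMF hqP V S (S ω) (V ω)
      have d3 := pushPMF_mul_condPMF hqP T VS (VS ω) (T ω)
      have d4 : pushPMF q (fun ω => (VT ω, S ω)) (VT ω, S ω)
          = pushPMF q (fun ω => (T ω, VS ω)) (T ω, VS ω) := by
        refine pushPMF_eq_of_iff q _ _ fun ω' => ?_
        simp only [VT, VS, Prod.ext_iff]
        tauto
      refine mul_left_cancel₀ p5.ne' ?_
      rw [d1, d4, ← d3, ← mul_assoc, d2]
    rw [e1, show pushPMF q VT (VT ω) = _ from (hVT (V ω) (T ω)).symm, div_mul_div_comm]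
  have h1' : R0 + R1 ≤ mutInfoOf q VT Z1 - (I1 + I2) := by
    rw [← hVTS, add_comm]; exact h1
  have h2' : R0 + R2 ≤ mutInfoOf q V Z2 - I1 := by
    rw [← hVS, add_comm]; exact h2
  obtain ⟨ρ1, ρ1pos, ρ1lt, tail1⟩ := exists_ratio_tail_le hqP (c := I1 + δ / 8)
    (a := fun ω => condPMF q V S (S ω) (V ω)) (b := fun ω => pushPMF q V (V ω))
    (fun ω => condPMF_pos hqP V S) hPpos (by linarith)
  obtain ⟨ρ2, ρ2pos, ρ2lt, tail2⟩ := exists_ratio_tail_le hqP (c := I2 + δ / 8)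
    (a := fun ω => condPMF q T VS (VS ω) (T ω)) (b := fun ω => condPMF q T V (V ω) (T ω))
    (fun ω => condPMF_pos hqP T VS) hKpos (by linarith)
  have neg_logb : ∀ x y : ℝ, Real.logb 2 (x / y) = -Real.logb 2 (y / x) := fun x y => by
    rw [← Real.logb_inv, inv_div]
  obtain ⟨ρ3, ρ3pos, ρ3lt, tail3⟩ := exists_ratio_tail_le hqP
    (c := -mutInfoOf q VT Z1 + δ / 8)
    (a := fun ω => pushPMF q V (V ω) * condPMF q T V (V ω) (T ω))
    (b := fun ω => condPMF q VT Z1 (Z1 ω) (VT ω))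
    (fun ω h => mul_pos (hPpos ω h) (hKpos ω h)) (fun ω => condPMF_pos hqP VT Z1) (by
      rw [mutInfoOf_eq_sum hqP VT Z1]
      simp_rw [hVT, neg_logb (pushPMF q VT _), mul_neg]
      rw [Finset.sum_neg_distrib]
      have : ∀ ω, pushPMF q VT (V ω, T ω) = pushPMF q VT (VT ω) := fun _ => rfl
      simp_rw [this]
      linarith)
  obtain ⟨ρ4, ρ4pos, ρ4lt, tail4⟩ := exists_ratio_tail_le hqP
    (c := -mutInfoOf q V Z2 + δ / 8) (a := fun ω => pushPMF q V (V ω))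
    (b := fun ω => condPMF q V Z2 (Z2 ω) (V ω)) hPpos (fun ω => condPMF_pos hqP V Z2) (by
      rw [mutInfoOf_eq_sum hqP V Z2]
      simp_rw [neg_logb (pushPMF q V _), mul_neg]
      rw [Finset.sum_neg_distrib]
      linarith)
  obtain ⟨ρ, hρ0, hρ1, l1, l2, l3, l4, l5⟩ : ∃ ρ : ℝ, 0 < ρ ∧ ρ < 1 ∧ ρ1 ≤ ρ ∧ ρ2 ≤ ρ ∧
      ρ3 ≤ ρ ^ 2 ∧ ρ4 ≤ ρ ^ 2 ∧ (2 : ℝ) ^ (-(δ / 8)) ≤ ρ := by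
    have hsq : ∀ x : ℝ, x < 1 → √x < 1 := fun x h => by
      rw [Real.sqrt_lt' one_pos]; simpa using h
    refine ⟨max ((2 : ℝ) ^ (-(δ / 8))) (max (max ρ1 ρ2) (max √ρ3 √ρ4)), ?_, ?_, ?_, ?_, ?_, ?_, ?_⟩
    · exact lt_max_of_lt_left (by positivity)
    · refine max_lt (Real.rpow_lt_one_of_one_lt_of_neg (by norm_num) (by linarith))
        (max_lt (max_lt ρ1lt ρ2lt) (max_lt (hsq _ ρ3lt) (hsq _ ρ4lt)))
    · simp
    · simp
    · rw [← Real.sqrt_le_left (by positivity)]; simp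
    · rw [← Real.sqrt_le_left (by positivity)]; simp
    · simp
  obtain ⟨n, hn, hbound⟩ := exists_mul_pow_le_two_rpow (C := 31) hρ0 hρ1 (by norm_num)
    (show b < 1 by linarith)
  obtain ⟨enc, dec1, dec2, hPe⟩ := exists_block_code hPS hW f (pushPMF_isPMF hqP V)
    (fun v => condPMF_isPMF hqP T V v) (fun s => condPMF_isPMF hqP V S s)
    (qt := fun s v => condPMF q T VS (v, s)) (fun s v => condPMF_isPMF hqP T VS (v, s))
    (fun y => condPMF_isPMF hqP VT Z1 y) (fun y => condPMF_isPMF hqP V Z2 y) haux (n := n)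
    (by positivity) (by positivity) (by positivity) (by positivity) (η := ρ ^ n) (by positivity)
    (tail1 n) (tail2 n) (tail3 n) (tail4 n) (codeSize_pos (I1 + 2 * (δ / 8)) n)
    (codeSize_pos (I2 + 2 * (δ / 8)) n) (codeSize_pos (max (R0 - δ) 0) n)
    (codeSize_pos (max (R1 - δ) 0) n) (codeSize_pos (max (R2 - δ) 0) n)
  refine ⟨n, _, _, _, enc, dec1, dec2, hn, codeSize_pos _ _, codeSize_pos _ _, codeSize_pos _ _,
    (le_max_left _ _).trans (le_logb_codeSize _ hn), (le_max_left _ _).trans (le_logb_codeSize _ hn),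
    (le_max_left _ _).trans (le_logb_codeSize _ hn), hPe.trans (le_trans ?_ hbound)⟩
  have e1 := message_mul_rows_le hR0 hR1 hδ hI1nn hI2nn h1' n
  have e2 := message_mul_clouds_le hR0 hR2 hδ hI1nn h2' n
  have e3 := exp_neg_codeSize_div_le I1 (δ / 8) n
  have e4 := exp_neg_codeSize_div_le I2 (δ / 8) n
  have e5 : ((2 : ℝ) ^ (-(δ / 8))) ^ n ≤ ρ ^ n := pow_le_pow_left₀ (by positivity) l5 n
  have e6 := pow_le_pow_left₀ ρ1pos.le l1 n
  have e7 := pow_le_pow_left₀ ρ2pos.le l2 n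
  have e8 : (ρ3 ^ n + ρ4 ^ n) / ρ ^ n ≤ 2 * ρ ^ n := by
    rw [div_le_iff₀ (by positivity)]
    have f3 := pow_le_pow_left₀ ρ3pos.le l3 n
    have f4 := pow_le_pow_left₀ ρ4pos.le l4 n
    have : (ρ ^ 2) ^ n = ρ ^ n * ρ ^ n := by rw [← pow_mul, ← pow_add]; congr 1; ring
    linarith
  linarith
end
end

section
/- Consider the example channel with parameter p ∈ [0,1). Let U be any finite-valued random variable jointly distributed with S via a conditional pmf P_{U|S}, let X = x(U,S) for a function x : U × S → {1,2,3,4}, and let Y₁ be the deterministic channel output. Then H(U|S) − H(U|(Y₁,S)) = (1−p)·(H(U | S=0) − H(U | Y₁, S=0)) = (1−p)·(H(Y₁ | S=0) − H(Y₁ | U, S=0)) ≤ (1−p)·H(Y₁) ≤ 2 − 2p, where entropies conditioned on S=0 are computed under the conditional distribution given the event {S = 0}. -/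
open scoped BigOperators

noncomputable section

/-- State pmf of the example channel: `P_S(0) = 1-p`, `P_S(s) = p/4` for `s ≠ 0`.
The state alphabet `{0,1,2,3,4}` is modelled by `Fin 5`. -/
def exPS (p : ℝ) : Fin 5 → ℝ := fun s => if s = 0 then 1 - p else p / 4

/-- First output of the example channel: `Y₁ = X` if `S = 0`, `Y₁ = S` otherwise.
The input/output alphabet `{1,2,3,4}` is modelled by `Fin 4` (index `i ↦ symbol i+1`),
so state symbol `s ≠ 0` corresponds to output index `s - 1`. -/
def exY1 (x : Fin 4) (s : Fin 5) : Fin 4 :=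
  if (s : ℕ) = 0 then x else ⟨(s : ℕ) - 1, by have := s.isLt; omega⟩

/-- Second output of the example channel: `Y₂ = 0` if `Y₁ ∈ {1,2}`, `Y₂ = 1` if
`Y₁ ∈ {3,4}` (i.e. output indices `{0,1}` vs `{2,3}`). -/
def exY2 (y : Fin 4) : Bool := decide (2 ≤ (y : ℕ))

lemma pushPMF_nonneg {α β : Type*} [Fintype α] [DecidableEq β] {p : α → ℝ} (hp : ∀ a, 0 ≤ p a)
    (f : α → β) (b : β) : 0 ≤ pushPMF p f b :=
  Finset.sum_nonneg fun a _ => by split_ifs <;> simp [hp]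

lemma IsPMF.pushPMF {α β : Type*} [Fintype α] [Fintype β] [DecidableEq β] {p : α → ℝ}
    (hp : IsPMF p) (f : α → β) : IsPMF (pushPMF p f) := by
  refine ⟨pushPMF_nonneg hp.1 f, ?_⟩
  unfold _root_.pushPMF
  rw [Finset.sum_comm, ← hp.2]
  simp

lemma margSnd_pushPMF {Ω α β : Type*} [Fintype Ω] [Fintype α] [Fintype β] [DecidableEq α]
    [DecidableEq β] (p : Ω → ℝ) (A : Ω → α) (B : Ω → β) :
    margSnd (pushPMF p fun ω => (A ω, B ω)) = pushPMF p B := by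
  funext b
  unfold margSnd pushPMF
  rw [Finset.sum_comm]
  refine Finset.sum_congr rfl fun ω _ => ?_
  by_cases h : B ω = b <;> simp [h]

lemma condEnt_eq_ent_sub_ent {α β : Type*} [Fintype α] [Fintype β] {p : α × β → ℝ}
    (hp : ∀ x, 0 ≤ p x) : condEnt p = ent p - ent (margSnd p) := by
  have hterm : ∀ a b, p (a, b) * Real.logb 2 (p (a, b) / margSnd p b)
      = p (a, b) * Real.logb 2 (p (a, b)) - p (a, b) * Real.logb 2 (margSnd p b) := by
    intro a b
    by_cases h : p (a, b) = 0
    · simp [h]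
    · have hle : p (a, b) ≤ margSnd p b :=
        Finset.single_le_sum (f := fun a => p (a, b)) (fun a _ => hp (a, b)) (Finset.mem_univ a)
      have hpos : 0 < p (a, b) := lt_of_le_of_ne (hp _) (Ne.symm h)
      rw [Real.logb_div h (hpos.trans_le hle).ne', mul_sub]
  unfold condEnt ent
  simp only [hterm, Finset.sum_sub_distrib, Fintype.sum_prod_type]
  have hswap : ∑ a, ∑ b, p (a, b) * Real.logb 2 (margSnd p b)
      = ∑ b, margSnd p b * Real.logb 2 (margSnd p b) := by
    rw [Finset.sum_comm]
    exact Finset.sum_congr rfl fun b _ => (Finset.sum_mul _ _ _).symm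
  rw [hswap]
  ring

/-- The chain rule `H(A|B) = H(A,B) - H(B)`. -/
lemma condEntOf_eq_entOf_sub_entOf {Ω α β : Type*} [Fintype Ω] [Fintype α] [Fintype β]
    [DecidableEq α] [DecidableEq β] {p : Ω → ℝ} (hp : ∀ ω, 0 ≤ p ω) (A : Ω → α) (B : Ω → β) :
    condEntOf p A B = entOf p (fun ω => (A ω, B ω)) - entOf p B := by
  unfold condEntOf entOf
  rw [condEnt_eq_ent_sub_ent (pushPMF_nonneg hp _), margSnd_pushPMF]

lemma entOf_pair_swap {Ω α β : Type*} [Fintype Ω] [Fintype α] [Fintype β] [DecidableEq α]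
    [DecidableEq β] (p : Ω → ℝ) (A : Ω → α) (B : Ω → β) :
    entOf p (fun ω => (A ω, B ω)) = entOf p (fun ω => (B ω, A ω)) := by
  unfold entOf ent pushPMF
  simp only [Fintype.sum_prod_type, Prod.mk.injEq]
  rw [Finset.sum_comm]
  simp only [and_comm]

/-- Adjoining a variable that is almost surely a function of `A` does not change `H(A)`. -/
lemma entOf_pair_of_determined {Ω α β : Type*} [Fintype Ω] [Fintype α] [Fintype β]
    [DecidableEq α] [DecidableEq β] {p : Ω → ℝ} {A : Ω → α} {B : Ω → β} (f : α → β)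
    (h : ∀ ω, p ω ≠ 0 → B ω = f (A ω)) :
    entOf p (fun ω => (A ω, B ω)) = entOf p A := by
  have hpush : ∀ a b, pushPMF p (fun ω => (A ω, B ω)) (a, b)
      = if b = f a then pushPMF p A a else 0 := by
    intro a b
    unfold pushPMF
    have hite : (if b = f a then ∑ ω, (if A ω = a then p ω else 0) else 0)
        = ∑ ω, if b = f a then (if A ω = a then p ω else 0) else 0 := by
      split_ifs <;> simp
    rw [hite]
    refine Finset.sum_congr rfl fun ω _ => ?_
    by_cases hω : p ω = 0
    · simp [hω]
    · have := h ω hω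
      by_cases hA : A ω = a
      · subst hA
        simp [this, eq_comm]
      · simp [hA]
  unfold entOf ent
  simp [Fintype.sum_prod_type, hpush, ite_mul]

lemma condEntOf_sub_condEntOf_pair {Ω α β γ : Type*} [Fintype Ω] [Fintype α] [Fintype β]
    [Fintype γ] [DecidableEq α] [DecidableEq β] [DecidableEq γ] {p : Ω → ℝ}
    (hp : ∀ ω, 0 ≤ p ω) {A : Ω → α} {B : Ω → β} {C : Ω → γ} (f : α → γ → β)
    (h : ∀ ω, B ω = f (A ω) (C ω)) :
    condEntOf p A C - condEntOf p A (fun ω => (B ω, C ω)) = condEntOf p B C := by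
  have h₁ := entOf_pair_of_determined (p := p) (A := fun ω => (A ω, C ω))
    (B := fun ω => (A ω, (B ω, C ω))) (fun x => (x.1, (f x.1 x.2, x.2)))
    (fun ω _ => by simp [h])
  have h₂ := entOf_pair_of_determined (p := p) (A := fun ω => (A ω, (B ω, C ω)))
    (B := fun ω => (A ω, C ω)) (fun x => (x.1, x.2.2)) (fun ω _ => rfl)
  rw [entOf_pair_swap] at h₂
  simp only [condEntOf_eq_entOf_sub_entOf hp]
  linarith

lemma entOf_sub_condEntOf_comm {Ω α β : Type*} [Fintype Ω] [Fintype α] [Fintype β]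
    [DecidableEq α] [DecidableEq β] {p : Ω → ℝ} (hp : ∀ ω, 0 ≤ p ω) (A : Ω → α) (B : Ω → β) :
    entOf p A - condEntOf p A B = entOf p B - condEntOf p B A := by
  rw [condEntOf_eq_entOf_sub_entOf hp, condEntOf_eq_entOf_sub_entOf hp, entOf_pair_swap]
  ring

lemma condEntOf_eq_zero_of_determined {Ω α β : Type*} [Fintype Ω] [Fintype α] [Fintype β]
    [DecidableEq α] [DecidableEq β] {p : Ω → ℝ} (hp : ∀ ω, 0 ≤ p ω) {A : Ω → α} {B : Ω → β}
    (f : α → β) (h : ∀ ω, p ω ≠ 0 → B ω = f (A ω)) : condEntOf p B A = 0 := by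
  rw [condEntOf_eq_entOf_sub_entOf hp, entOf_pair_swap, entOf_pair_of_determined f h, sub_self]

lemma ent_eq_sum_negMulLog {α : Type*} [Fintype α] (p : α → ℝ) :
    ent p = (∑ a, Real.negMulLog (p a)) / Real.log 2 := by
  unfold ent
  rw [Finset.sum_div, ← Finset.sum_neg_distrib]
  refine Finset.sum_congr rfl fun a _ => ?_
  rw [Real.negMulLog, Real.logb]
  ring

lemma IsPMF.ent_le_logb_card {α : Type*} [Fintype α] {p : α → ℝ} (hp : IsPMF p) :
    ent p ≤ Real.logb 2 (Fintype.card α) := by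
  have hne : Nonempty α := by
    by_contra h
    rw [not_nonempty_iff] at h
    simpa using hp.2
  have hn : (0 : ℝ) < Fintype.card α := by exact_mod_cast Fintype.card_pos
  have hJ := Real.concaveOn_negMulLog.le_map_sum (t := Finset.univ)
    (w := fun _ : α => (Fintype.card α : ℝ)⁻¹) (p := p) (fun _ _ => by positivity)
    (by simp [hn.ne']) (fun a _ => hp.1 a)
  simp only [smul_eq_mul, ← Finset.mul_sum, hp.2, mul_one] at hJ
  rw [Real.negMulLog, Real.log_inv, neg_mul_neg] at hJ
  rw [ent_eq_sum_negMulLog, Real.logb]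
  gcongr
  exact le_of_mul_le_mul_left hJ (by positivity)

lemma ent_const_inv_card (α : Type*) [Fintype α] [Nonempty α] :
    ent (fun _ : α => (Fintype.card α : ℝ)⁻¹) = Real.logb 2 (Fintype.card α) := by
  have hn : (Fintype.card α : ℝ) ≠ 0 := by exact_mod_cast Fintype.card_ne_zero
  simp [ent, Real.logb_inv, hn]

/-- Entropy is concave on nonnegative functions. -/
lemma le_ent_mix {α : Type*} [Fintype α] {p r : α → ℝ} (hp : ∀ a, 0 ≤ p a) (hr : ∀ a, 0 ≤ r a)
    {s t : ℝ} (hs : 0 ≤ s) (ht : 0 ≤ t) (hst : s + t = 1) :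
    s * ent p + t * ent r ≤ ent (fun a => s * p a + t * r a) := by
  simp only [ent_eq_sum_negMulLog]
  rw [← mul_div_assoc, ← mul_div_assoc, ← add_div, Finset.mul_sum, Finset.mul_sum,
    ← Finset.sum_add_distrib]
  gcongr with a
  exact Real.concaveOn_negMulLog.2 (hp a) (hr a) hs ht hst

/-- Mixing a pmf with the uniform distribution does not decrease its entropy. -/
lemma IsPMF.ent_le_ent_mix_uniform {α : Type*} [Fintype α] [Nonempty α] {p : α → ℝ}
    (hp : IsPMF p) {t : ℝ} (ht0 : 0 ≤ t) (ht1 : t ≤ 1) :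
    ent p ≤ ent (fun a => (1 - t) * p a + t * (Fintype.card α : ℝ)⁻¹) := by
  refine le_trans ?_ (le_ent_mix hp.1 (fun _ => by positivity) (sub_nonneg.2 ht1) ht0 (by ring))
  rw [ent_const_inv_card]
  nlinarith [hp.ent_le_logb_card]

lemma logb_two_card_fin_four : Real.logb 2 (Fintype.card (Fin 4)) = 2 := by
  rw [Fintype.card_fin, show ((4 : ℕ) : ℝ) = 2 ^ (2 : ℝ) by norm_num]
  exact Real.logb_rpow (by norm_num) (by norm_num)

section ExampleChannel

variable {U : Type} [Fintype U] (p : ℝ) {PU : Fin 5 → U → ℝ} (xf : U → Fin 5 → Fin 4)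

lemma exPS_nonneg {p : ℝ} (hp0 : 0 ≤ p) (hp1 : p ≤ 1) (s : Fin 5) : 0 ≤ exPS p s := by
  unfold exPS
  split_ifs <;> linarith

lemma isPMF_example_joint {p : ℝ} (hp0 : 0 ≤ p) (hp1 : p ≤ 1) (hPU : ∀ s, IsPMF (PU s)) :
    IsPMF (fun ω : U × Fin 5 => exPS p ω.2 * PU ω.2 ω.1) := by
  refine ⟨fun ω => mul_nonneg (exPS_nonneg hp0 hp1 _) ((hPU _).1 _), ?_⟩
  rw [Fintype.sum_prod_type_right]
  simp only [← Finset.mul_sum, (hPU _).2, mul_one]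
  simp [Fin.sum_univ_five, exPS]
  ring

lemma exY1_zero (x : Fin 4) : exY1 x 0 = x := by simp [exY1]

lemma exY1_succ (x i : Fin 4) : exY1 x i.succ = i := by simp [exY1]

lemma pushPMF_example_state (hPU : ∀ s, IsPMF (PU s)) :
    pushPMF (fun ω : U × Fin 5 => exPS p ω.2 * PU ω.2 ω.1) (fun ω => ω.2) = exPS p := by
  funext s
  unfold pushPMF
  simp [Fintype.sum_prod_type, ← Finset.mul_sum, (hPU _).2]

lemma pushPMF_example_output_state_zero (y : Fin 4) :
    pushPMF (fun ω : U × Fin 5 => exPS p ω.2 * PU ω.2 ω.1)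
      (fun ω => (exY1 (xf ω.1 ω.2) ω.2, ω.2)) (y, 0)
      = (1 - p) * pushPMF (PU 0) (fun u => xf u 0) y := by
  unfold pushPMF
  simp [Fintype.sum_prod_type, Fin.sum_univ_succ, exY1_zero, exPS, Finset.mul_sum]

lemma pushPMF_example_output_state_succ (hPU : ∀ s, IsPMF (PU s)) (y i : Fin 4) :
    pushPMF (fun ω : U × Fin 5 => exPS p ω.2 * PU ω.2 ω.1)
      (fun ω => (exY1 (xf ω.1 ω.2) ω.2, ω.2)) (y, i.succ) = if i = y then p / 4 else 0 := by
  unfold pushPMF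
  rw [Fintype.sum_prod_type_right, Fin.sum_univ_succ]
  simp only [exY1_succ, Prod.mk.injEq, Fin.succ_inj, (Fin.succ_ne_zero _).symm, and_false,
    if_false, Finset.sum_const_zero, zero_add]
  rw [Finset.sum_eq_single i (by intro b _ hb; simp [hb]) (by simp)]
  by_cases h : i = y
  · simp [h, ← Finset.mul_sum, (hPU _).2, exPS]
  · simp [h]

lemma pushPMF_example_output (hPU : ∀ s, IsPMF (PU s)) :
    pushPMF (fun ω : U × Fin 5 => exPS p ω.2 * PU ω.2 ω.1) (fun ω => exY1 (xf ω.1 ω.2) ω.2)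
      = fun y => (1 - p) * pushPMF (PU 0) (fun u => xf u 0) y
        + p * (Fintype.card (Fin 4) : ℝ)⁻¹ := by
  funext y
  unfold pushPMF
  rw [Fintype.sum_prod_type_right, Fin.sum_univ_succ]
  simp only [exY1_zero, exY1_succ]
  congr 1
  · simp [Finset.mul_sum, exPS]
  · rw [Finset.sum_eq_single y (by intro b _ hb; simp [hb]) (by simp)]
    simp [← Finset.mul_sum, (hPU _).2, exPS, div_eq_mul_inv]

lemma condEntOf_example_output_state {p : ℝ} (hp1 : p < 1) (hPU : ∀ s, IsPMF (PU s)) :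
    condEntOf (fun ω : U × Fin 5 => exPS p ω.2 * PU ω.2 ω.1)
      (fun ω => exY1 (xf ω.1 ω.2) ω.2) (fun ω => ω.2)
      = (1 - p) * ent (pushPMF (PU 0) fun u => xf u 0) := by
  have h1p : 1 - p ≠ 0 := (sub_pos.2 hp1).ne'
  have hsucc : ∀ y i : Fin 4, (if i = y then p / 4 else 0)
      * Real.logb 2 ((if i = y then p / 4 else 0) / (p / 4)) = 0 := by
    intro y i
    by_cases h : i = y
    · by_cases hp : p = 0 <;> simp [h, hp]
    · simp [h]
  unfold condEntOf condEnt
  simp only [margSnd_pushPMF, pushPMF_example_state p hPU, Fin.sum_univ_succ (n := 4),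
    pushPMF_example_output_state_zero, pushPMF_example_output_state_succ p xf hPU]
  simp only [exPS, Fin.succ_ne_zero, if_true, if_false, hsucc, Finset.sum_const_zero, add_zero,
    mul_div_cancel_left₀ _ h1p]
  unfold ent
  rw [mul_neg, Finset.mul_sum]
  simp only [mul_assoc]

lemma entOf_example_output_given_zero {p : ℝ} (hp1 : p < 1) :
    entOf (fun ω : U × Fin 5 => if ω.2 = 0 then exPS p ω.2 * PU ω.2 ω.1 / (1 - p) else 0)
      (fun ω => exY1 (xf ω.1 ω.2) ω.2) = ent (pushPMF (PU 0) fun u => xf u 0) := by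
  have h1p : 1 - p ≠ 0 := (sub_pos.2 hp1).ne'
  unfold entOf
  congr 1
  funext y
  unfold pushPMF
  rw [Fintype.sum_prod_type_right, Fin.sum_univ_succ]
  simp [exY1_zero, exPS, mul_div_cancel_left₀ _ h1p]

end ExampleChannel

/-- for the example channel with `p ∈ [0,1)` and any auxiliary `U` with
conditional pmf `P_{U|S}` and input `X = x(U,S)`, writing `q` for the joint pmf of
`(U,S)` and `q₀` for its conditional version given the event `{S = 0}`:
`H(U|S) − H(U|(Y₁,S)) = (1−p)·(H(U|S=0) − H(U|Y₁,S=0))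
 = (1−p)·(H(Y₁|S=0) − H(Y₁|U,S=0)) ≤ (1−p)·H(Y₁) ≤ 2 − 2p`. -/
theorem example_channel_entropy_chain (p : ℝ) (hp0 : 0 ≤ p) (hp1 : p < 1)
    (U : Type) [Fintype U] [DecidableEq U]
    (PU : Fin 5 → U → ℝ) (hPU : ∀ s, IsPMF (PU s))
    (xf : U → Fin 5 → Fin 4)
    (q : U × Fin 5 → ℝ) (hq : q = fun ω => exPS p ω.2 * PU ω.2 ω.1)
    (q0 : U × Fin 5 → ℝ) (hq0 : q0 = fun ω => if ω.2 = 0 then q ω / (1 - p) else 0) :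
    (condEntOf q (fun ω => ω.1) (fun ω => ω.2)
        - condEntOf q (fun ω => ω.1) (fun ω => (exY1 (xf ω.1 ω.2) ω.2, ω.2))
      = (1 - p) * (entOf q0 (fun ω => ω.1)
          - condEntOf q0 (fun ω => ω.1) (fun ω => exY1 (xf ω.1 ω.2) ω.2))) ∧
    ((1 - p) * (entOf q0 (fun ω => ω.1)
        - condEntOf q0 (fun ω => ω.1) (fun ω => exY1 (xf ω.1 ω.2) ω.2))
      = (1 - p) * (entOf q0 (fun ω => exY1 (xf ω.1 ω.2) ω.2)
          - condEntOf q0 (fun ω => exY1 (xf ω.1 ω.2) ω.2) (fun ω => ω.1))) ∧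
    ((1 - p) * (entOf q0 (fun ω => exY1 (xf ω.1 ω.2) ω.2)
        - condEntOf q0 (fun ω => exY1 (xf ω.1 ω.2) ω.2) (fun ω => ω.1))
      ≤ (1 - p) * entOf q (fun ω => exY1 (xf ω.1 ω.2) ω.2)) ∧
    ((1 - p) * entOf q (fun ω => exY1 (xf ω.1 ω.2) ω.2) ≤ 2 - 2 * p) := by
  have hqPMF : IsPMF q := hq ▸ isPMF_example_joint hp0 hp1.le hPU
  have hq0nn : ∀ ω, 0 ≤ q0 ω := by
    intro ω
    rw [hq0]
    dsimp only
    split_ifs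
    · exact div_nonneg (hqPMF.1 ω) (sub_nonneg.2 hp1.le)
    · exact le_rfl
  have hY0 : condEntOf q0 (fun ω => exY1 (xf ω.1 ω.2) ω.2) (fun ω => ω.1) = 0 := by
    refine condEntOf_eq_zero_of_determined hq0nn (fun u => xf u 0) fun ω hω => ?_
    have hs : ω.2 = 0 := by
      by_contra h
      simp [hq0, h] at hω
    simp [hs, exY1_zero]
  have hent0 : entOf q0 (fun ω => exY1 (xf ω.1 ω.2) ω.2)
      = ent (pushPMF (PU 0) fun u => xf u 0) := by
    subst hq hq0
    exact entOf_example_output_given_zero xf hp1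
  have hsymm := entOf_sub_condEntOf_comm hq0nn (fun ω => ω.1) (fun ω => exY1 (xf ω.1 ω.2) ω.2)
  refine ⟨?_, by rw [hsymm], ?_, ?_⟩
  · rw [condEntOf_sub_condEntOf_pair hqPMF.1 (fun u s => exY1 (xf u s) s) (fun _ => rfl), hsymm,
      hY0, hent0, sub_zero, hq]
    exact condEntOf_example_output_state xf hp1 hPU
  · refine mul_le_mul_of_nonneg_left ?_ (sub_nonneg.2 hp1.le)
    rw [hY0, hent0, sub_zero, hq, entOf, pushPMF_example_output p xf hPU]
    exact ((hPU 0).pushPMF _).ent_le_ent_mix_uniform hp0 hp1.le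
  · have h := (hqPMF.pushPMF fun ω => exY1 (xf ω.1 ω.2) ω.2).ent_le_logb_card
    rw [logb_two_card_fin_four] at h
    have := mul_le_mul_of_nonneg_left h (sub_nonneg.2 hp1.le)
    unfold entOf
    linarith
end
end
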